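/- Let p, q be positive integers. Let G = SL(p+q, ℂ), let J = diag(I_p, -I_q), and let H = {A ∈ G : A* J A = J}, where A* denotes the conjugate transpose (H is the special pseudo-unitary group SU(p,q)). Then there is no discrete subgroup Γ of G acting properly discontinuously and cocompactly on the homogeneous space G/H; that is, SL(p+q,ℂ)/SU(p,q) admits no compact Clifford–Klein form. -/

import Mathlib

/-!
The homogeneous space `SL(p+q,ℂ)/SU(p,q)` (`p, q > 0`) admits no compact
Clifford–Klein form.
-/

open Matrix

set_option maxHeartbeats 1000000
set_option synthInstance.maxHeartbeats 1000000

noncomputable section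

/-- The special linear group `SL(p+q, ℂ)`, realized as the subgroup of `GL(p+q, ℂ)` of
matrices of determinant `1`; here `ℂ^{p+q}` is indexed by `Fin p ⊕ Fin q`. -/
def SLCpq (p q : ℕ) : Subgroup (GL (Fin p ⊕ Fin q) ℂ) where
  carrier := {A | A.val.det = 1}
  one_mem' := by simp
  mul_mem' := by
    intro A B hA hB
    show (A * B).val.det = 1
    rw [Units.val_mul, det_mul, hA, hB, mul_one]
  inv_mem' := by
    intro A hA
    show (A⁻¹).val.det = 1
    have h := congrArg Matrix.det (Units.mul_inv A)
    rw [det_mul, hA, one_mul] at h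
    simpa using h

/-- The matrix `J = diag(I_p, -I_q)`. -/
def JCpq (p q : ℕ) : Matrix (Fin p ⊕ Fin q) (Fin p ⊕ Fin q) ℂ :=
  Matrix.diagonal (Sum.elim (fun _ => 1) (fun _ => -1))

/-- The special pseudo-unitary group `SU(p,q)`, realized as the subgroup of
`SL(p+q,ℂ)` of matrices `A` with `A* J A = J`, where `A*` is the conjugate transpose
and `J = diag(I_p, -I_q)`. -/
def SUpq (p q : ℕ) : Subgroup ↥(SLCpq p q) where
  carrier := {A | A.val.valᴴ * JCpq p q * A.val.val = JCpq p q}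
  one_mem' := by
    show (1 : Matrix (Fin p ⊕ Fin q) (Fin p ⊕ Fin q) ℂ)ᴴ * JCpq p q * 1 = JCpq p q
    simp
  mul_mem' := by
    intro A B hA hB
    show (A * B).val.valᴴ * JCpq p q * (A * B).val.val = JCpq p q
    have h : (A * B).val.val = A.val.val * B.val.val := rfl
    have key : (A.val.val * B.val.val)ᴴ * JCpq p q * (A.val.val * B.val.val) =
        B.val.valᴴ * (A.val.valᴴ * JCpq p q * A.val.val) * B.val.val := by
      rw [conjTranspose_mul]
      simp only [Matrix.mul_assoc]
    rw [h, key, hA]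
    exact hB
  inv_mem' := by
    intro A hA
    show (A⁻¹).val.valᴴ * JCpq p q * (A⁻¹).val.val = JCpq p q
    have hAinv : A.val.val * (A⁻¹).val.val = 1 := by
      have h : (A⁻¹).val = (A.val)⁻¹ := rfl
      rw [h]; exact Units.mul_inv A.val
    calc (A⁻¹).val.valᴴ * JCpq p q * (A⁻¹).val.val
        = (A⁻¹).val.valᴴ * (A.val.valᴴ * JCpq p q * A.val.val) * (A⁻¹).val.val := by rw [hA]
      _ = (A.val.val * (A⁻¹).val.val)ᴴ * JCpq p q * (A.val.val * (A⁻¹).val.val) := by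
          rw [conjTranspose_mul]
          simp only [Matrix.mul_assoc]
      _ = JCpq p q := by rw [hAinv]; simp
  
section NullLagrangian

variable {σ : Type*} [Fintype σ] {E : Type*} [NormedAddCommGroup E] [NormedSpace ℝ E]

theorem fderiv_fderiv_apply {F : E → σ → ℂ} {p : E} (hF : ContDiffAt ℝ 2 F p) (a : E) :
    HasFDerivAt (fun x => fderiv ℝ F x a) ((fderiv ℝ (fderiv ℝ F) p).flip a) p := by
  have h : DifferentiableAt ℝ (fderiv ℝ F) p :=
    (hF.fderiv_right (m := 1) (by norm_num)).differentiableAt (by norm_num)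
  have := (h.hasFDerivAt).clm_apply (hasFDerivAt_const a p)
  rwa [ContinuousLinearMap.comp_zero, zero_add] at this

variable [DecidableEq σ]

/-- The complex determinant, as a real-multilinear function of the rows. -/
def detRows (σ : Type*) [Fintype σ] [DecidableEq σ] :
    ContinuousMultilinearMap ℝ (fun _ : σ => σ → ℂ) ℂ where
  toMultilinearMap :=
    (Matrix.detRowAlternating (R := ℂ) (n := σ)).toMultilinearMap.restrictScalars ℝ
  cont := by
    change Continuous fun M : σ → σ → ℂ => Matrix.det (Matrix.of M)
    exact Continuous.matrix_det continuous_id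

theorem detRows_apply (M : σ → σ → ℂ) : detRows σ M = Matrix.det (Matrix.of M) := rfl

theorem detRows_update_smul_sum (M : σ → σ → ℂ) (v : σ → ℂ) :
    ∑ j, detRows σ (Function.update M j v) • M j = detRows σ M • v := by
  have h := Matrix.mulVec_cramer (Matrix.of M)ᵀ v
  rw [Matrix.det_transpose] at h
  rw [detRows_apply, ← h]
  ext i
  simp only [Finset.sum_apply, Pi.smul_apply, smul_eq_mul, Matrix.mulVec, dotProduct]
  refine Finset.sum_congr rfl fun j _ => ?_
  rw [Matrix.cramer_transpose_apply, mul_comm]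
  rfl

theorem sum_detRows_update_update_eq_zero (M : σ → σ → ℂ) (v : σ → ℂ) (B : σ → σ → σ → ℂ)
    (hB : ∀ j k, B j k = B k j) :
    ∑ j, ∑ k ∈ Finset.univ.erase j,
      detRows σ (Function.update (Function.update M j v) k (B j k)) = 0 := by
  set T : σ → σ → ℂ := fun j k =>
    if j = k then 0 else detRows σ (Function.update (Function.update M j v) k (B j k)) with hT
  have hanti : ∀ j k, T j k = - T k j := by
    intro j k
    by_cases h : j = k
    · simp [hT, h]
    · simp only [hT, h, Ne.symm h, if_false, detRows_apply, hB k j]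
      have hne : k ≠ j := Ne.symm h
      have := (Matrix.detRowAlternating (R := ℂ) (n := σ)).map_swap
        (v := Function.update (Function.update M k v) j (B j k)) h
      rw [show Function.update (Function.update M j v) k (B j k) =
        Function.update (Function.update M k v) j (B j k) ∘ Equiv.swap j k from ?_]
      · exact this
      · ext i l
        rcases eq_or_ne i j with rfl | hij
        · simp [h, hne, Function.update_of_ne]
        · rcases eq_or_ne i k with rfl | hik
          · simp
          · simp [Equiv.swap_apply_of_ne_of_ne hij hik, Function.update_of_ne, hij, hik]
  have hsum : ∑ j, ∑ k ∈ Finset.univ.erase j,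
      detRows σ (Function.update (Function.update M j v) k (B j k)) = ∑ j, ∑ k, T j k := by
    refine Finset.sum_congr rfl fun j _ => ?_
    rw [← Finset.sum_erase Finset.univ (a := j) (f := T j) (by simp [hT])]
    refine Finset.sum_congr rfl fun k hk => ?_
    simp [hT, (Finset.ne_of_mem_erase hk).symm]
  rw [hsum]
  have h2 : ∑ j, ∑ k, T j k = - ∑ j, ∑ k, T j k := by
    conv_lhs => rw [Finset.sum_comm]
    simp only [← Finset.sum_neg_distrib]
    exact Finset.sum_congr rfl fun j _ => Finset.sum_congr rfl fun k _ => hanti k j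
  exact self_eq_neg.mp h2

/-- The rows `∂F/∂eⱼ` of the (transposed) Jacobian matrix of `F` along the directions `e`. -/
def jacRows (F : E → σ → ℂ) (e : σ → E) (x : E) : σ → σ → ℂ := fun j => fderiv ℝ F x (e j)

theorem hasFDerivAt_detRows {g : E → σ → σ → ℂ} {g' : σ → E →L[ℝ] (σ → ℂ)} {p : E}
    (hg : ∀ j, HasFDerivAt (fun x => g x j) (g' j) p) :
    HasFDerivAt (fun x => detRows σ (g x))
      (∑ j, ((detRows σ).toContinuousLinearMap (g p) j) ∘L g' j) p :=
  HasFDerivAt.multilinear_comp (f := detRows σ) hg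

theorem hasFDerivAt_update_jacRows {F : E → σ → ℂ} {p : E} (hF : ContDiffAt ℝ 2 F p)
    (e : σ → E) (e₀ : E) (j : σ) (k : σ) :
    HasFDerivAt (fun x => Function.update (jacRows F e x) j (fderiv ℝ F x e₀) k)
      ((fderiv ℝ (fderiv ℝ F) p).flip (Function.update e j e₀ k)) p := by
  have : (fun x => Function.update (jacRows F e x) j (fderiv ℝ F x e₀) k) =
      fun x => fderiv ℝ F x (Function.update e j e₀ k) := by
    ext1 x
    rcases eq_or_ne k j with rfl | h
    · simp
    · simp [h, jacRows]
  rw [this]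
  exact fderiv_fderiv_apply hF _

/-- The Piola identity: the derivative of a Jacobian determinant along a deformation is a
divergence. -/
theorem fderiv_detRows_jacRows {F : E → σ → ℂ} {p : E} (hF : ContDiffAt ℝ 2 F p)
    (e : σ → E) (e₀ : E) :
    fderiv ℝ (fun x => detRows σ (jacRows F e x)) p e₀ =
      ∑ j, fderiv ℝ (fun x => detRows σ (Function.update (jacRows F e x) j (fderiv ℝ F x e₀))) p
        (e j) := by
  set D2 := fderiv ℝ (fderiv ℝ F) p with hD2
  have hsymm : ∀ a b, D2 a b = D2 b a := fun a b =>
    (hF.isSymmSndFDerivAt (by simp)).eq a b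
  have h1 := hasFDerivAt_detRows (g := jacRows F e) (g' := fun j => D2.flip (e j))
    (p := p) (fun j => fderiv_fderiv_apply hF (e j))
  have h2 := fun j => hasFDerivAt_detRows
    (g := fun x => Function.update (jacRows F e x) j (fderiv ℝ F x e₀)) (p := p)
    (fun k => hasFDerivAt_update_jacRows hF e e₀ j k)
  rw [h1.fderiv]
  simp_rw [fun j => (h2 j).fderiv]
  simp only [FunLike.coe_sum, Finset.sum_apply, ContinuousLinearMap.comp_apply,
    ContinuousLinearMap.flip_apply, ContinuousMultilinearMap.toContinuousLinearMap_apply]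
  have h3 := sum_detRows_update_update_eq_zero (jacRows F e p) (fderiv ℝ F p e₀)
    (fun j k => D2 (e j) (e k)) (fun j k => hsymm _ _)
  have h4 : ∀ j, ∑ k, detRows σ (Function.update
      (Function.update (jacRows F e p) j (fderiv ℝ F p e₀)) k
        (D2 (e j) (Function.update e j e₀ k))) =
      detRows σ (Function.update (jacRows F e p) j (D2 e₀ (e j))) +
      ∑ k ∈ Finset.univ.erase j, detRows σ (Function.update
        (Function.update (jacRows F e p) j (fderiv ℝ F p e₀)) k (D2 (e j) (e k))) := by
    intro j
    rw [← Finset.add_sum_erase _ _ (Finset.mem_univ j)]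
    congr 1
    · simp [hsymm e₀]
    · refine Finset.sum_congr rfl fun k hk => ?_
      rw [Function.update_of_ne (Finset.ne_of_mem_erase hk)]
  simp_rw [← hD2, h4]
  rw [Finset.sum_add_distrib, h3, add_zero]

/-- The pull-back of a weighted top-degree form under a deformation `F` is closed, in divergence
form. The weight `u` is a function of `F`, to first order. -/
theorem fderiv_mul_detRows_jacRows {F : E → σ → ℂ} {u : E → ℂ} {p : E}
    (hF : ContDiffAt ℝ 2 F p) (hu : DifferentiableAt ℝ u p) (ℓ : (σ → ℂ) →ₗ[ℂ] ℂ)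
    (hℓ : ∀ h, fderiv ℝ u p h = ℓ (fderiv ℝ F p h)) (e : σ → E) (e₀ : E) :
    fderiv ℝ (fun x => u x * detRows σ (jacRows F e x)) p e₀ =
      ∑ j, fderiv ℝ (fun x => u x *
        detRows σ (Function.update (jacRows F e x) j (fderiv ℝ F x e₀))) p (e j) := by
  have h1 := (hasFDerivAt_detRows (g := jacRows F e)
    (p := p) (fun j => fderiv_fderiv_apply hF (e j))).differentiableAt
  have h2 := fun j => (hasFDerivAt_detRows
    (g := fun x => Function.update (jacRows F e x) j (fderiv ℝ F x e₀)) (p := p)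
    (fun k => hasFDerivAt_update_jacRows hF e e₀ j k)).differentiableAt
  rw [fderiv_fun_mul hu h1]
  simp_rw [fun j => fderiv_fun_mul hu (h2 j)]
  simp only [_root_.add_apply, _root_.smul_apply, smul_eq_mul, Finset.sum_add_distrib,
    ← Finset.mul_sum]
  rw [fderiv_detRows_jacRows hF e e₀]
  congr 1
  simp only [hℓ]
  have := congrArg ℓ (detRows_update_smul_sum (jacRows F e p) (fderiv ℝ F p e₀))
  rw [map_sum, map_smul] at this
  simp only [map_smul, smul_eq_mul] at this
  rw [← this]
  rfl

end NullLagrangian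

section IntegralIdentities

open MeasureTheory

variable {σ : Type*} [Fintype σ]

theorem integrable_smul_of_continuousAt {φ : (σ → ℝ) → ℝ} (hφ : Continuous φ)
    (hc : HasCompactSupport φ) {G : (σ → ℝ) → ℂ} (hG : ∀ x ∈ tsupport φ, ContinuousAt G x) :
    Integrable fun x => φ x • G x := by
  refine Continuous.integrable_of_hasCompactSupport ?_ hc.smul_right
  refine continuous_of_tsupport fun x hx => ?_
  exact hφ.continuousAt.smul (hG x (tsupport_smul_subset_left φ G hx))

theorem integrable_fderiv_smul_of_continuousAt {φ : (σ → ℝ) → ℝ} (hφ : ContDiff ℝ 1 φ)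
    (hc : HasCompactSupport φ) {G : (σ → ℝ) → ℂ} (hG : ∀ x ∈ tsupport φ, ContinuousAt G x)
    (v : σ → ℝ) : Integrable fun x => fderiv ℝ φ x v • G x := by
  refine integrable_smul_of_continuousAt (φ := fun x => fderiv ℝ φ x v)
    ((hφ.continuous_fderiv (by norm_num)).clm_apply continuous_const) (hc.fderiv_apply ℝ v)
    fun x hx => hG x ?_
  exact tsupport_fderiv_apply_subset ℝ v hx

theorem contDiff_of_contDiffAt_tsupport {E F : Type*} [NormedAddCommGroup E] [NormedSpace ℝ E]
    [NormedAddCommGroup F] [NormedSpace ℝ F] {n : WithTop ℕ∞} {f : E → F}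
    (hf : ∀ x ∈ tsupport f, ContDiffAt ℝ n f x) : ContDiff ℝ n f := by
  refine contDiff_iff_contDiffAt.2 fun x => ?_
  by_cases hx : x ∈ tsupport f
  · exact hf x hx
  · exact contDiffAt_const.congr_of_eventuallyEq (notMem_tsupport_iff_eventuallyEq.1 hx)

theorem hasDerivAt_integral_of_contDiff {h : ℝ × (σ → ℝ) → ℂ} (hh : ContDiff ℝ 1 h)
    {K : Set (σ → ℝ)} (hK : IsCompact K) (h0 : ∀ t, ∀ x ∉ K, h (t, x) = 0) (t : ℝ) :
    HasDerivAt (fun s => ∫ x, h (s, x)) (∫ x, fderiv ℝ h (t, x) (1, 0)) t := by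
  have hd : ∀ s x, HasDerivAt (fun s => h (s, x)) (fderiv ℝ h (s, x) (1, 0)) s := by
    intro s x
    have h1 := ((hh.differentiable (by norm_num)) (s, x)).hasFDerivAt
    have h2 : HasDerivAt (fun s : ℝ => (s, x)) ((1 : ℝ), (0 : σ → ℝ)) s :=
      (hasDerivAt_id s).prodMk (hasDerivAt_const s x)
    exact h1.comp_hasDerivAt s h2
  have hcont : Continuous fun p : ℝ × (σ → ℝ) => fderiv ℝ h p (1, 0) :=
    (hh.continuous_fderiv (by norm_num)).clm_apply continuous_const
  have hz : ∀ s, ∀ x ∉ K, fderiv ℝ h (s, x) (1, 0) = 0 := by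
    intro s x hx
    have := hd s x
    simp only [h0 _ x hx] at this
    exact this.unique (hasDerivAt_const s (0 : ℂ))
  obtain ⟨C, hC⟩ := ((isCompact_Icc (a := t - 1) (b := t + 1)).prod hK).exists_bound_of_continuousOn
    hcont.continuousOn
  have h_int : ∀ s, Integrable fun x => h (s, x) := fun s =>
    (hh.continuous.comp (Continuous.prodMk_right s)).integrable_of_hasCompactSupport
      (HasCompactSupport.intro hK fun x hx => h0 s x hx)
  refine (hasDerivAt_integral_of_dominated_loc_of_deriv_le (μ := volume)
    (F := fun s x => h (s, x)) (F' := fun s x => fderiv ℝ h (s, x) (1, 0))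
    (bound := K.indicator fun _ => C) (s := Set.Icc (t - 1) (t + 1))
    (Icc_mem_nhds (by linarith) (by linarith)) (Filter.Eventually.of_forall fun s => (h_int s).1)
    (h_int t) (hcont.comp (Continuous.prodMk_right t)).aestronglyMeasurable ?_ ?_ ?_).2
  · refine Filter.Eventually.of_forall fun x s hs => ?_
    by_cases hx : x ∈ K
    · simpa [hx] using hC (s, x) ⟨hs, hx⟩
    · simp [hx, hz s x hx]
  · exact (integrableOn_const (hK.measure_lt_top.ne)).integrable_indicator hK.measurableSet
  · exact Filter.Eventually.of_forall fun x s _ => hd s x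

theorem contDiffAt_fderiv_apply {E : Type*} [NormedAddCommGroup E] [NormedSpace ℝ E]
    {F : E → σ → ℂ} {p : E} (hF : ContDiffAt ℝ 2 F p) (a : E) :
    ContDiffAt ℝ 1 (fun x => fderiv ℝ F x a) p :=
  (hF.fderiv_right (m := 1) (by norm_num)).clm_apply contDiffAt_const

variable [DecidableEq σ]

/-- The spatial coordinate directions in `ℝ × ℝ^σ`. -/
def spaceDir (j : σ) : ℝ × (σ → ℝ) := (0, Pi.single j 1)

/-- The time direction in `ℝ × ℝ^σ`. -/
def timeDir : ℝ × (σ → ℝ) := (1, 0)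

/-- The components of the field `u • adj(DF) ∂ₜF` attached to a deformation `F` and a weight `u`. -/
def fluxField (F : ℝ × (σ → ℝ) → σ → ℂ) (u : ℝ × (σ → ℝ) → ℂ) (p : ℝ × (σ → ℝ)) (j : σ) : ℂ :=
  u p * detRows σ (Function.update (jacRows F spaceDir p) j (fderiv ℝ F p timeDir))

theorem contDiffAt_detRows {E : Type*} [NormedAddCommGroup E] [NormedSpace ℝ E]
    {n : WithTop ℕ∞} {g : E → σ → σ → ℂ} {p : E}
    (hg : ∀ j, ContDiffAt ℝ n (fun x => g x j) p) : ContDiffAt ℝ n (fun x => detRows σ (g x)) p :=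
  (detRows σ).contDiff.contDiffAt.comp p (contDiffAt_pi.2 hg)

theorem contDiffAt_fluxField {F : ℝ × (σ → ℝ) → σ → ℂ} {u : ℝ × (σ → ℝ) → ℂ} {p : ℝ × (σ → ℝ)}
    (hF : ContDiffAt ℝ 2 F p) (hu : ContDiffAt ℝ 1 u p) (j : σ) :
    ContDiffAt ℝ 1 (fun x => fluxField F u x j) p := by
  refine hu.mul (contDiffAt_detRows fun k => ?_)
  rcases eq_or_ne k j with rfl | h
  · simpa using contDiffAt_fderiv_apply hF _
  · simpa [h, jacRows] using contDiffAt_fderiv_apply hF _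

theorem hasDerivAt_integral_smul_mul_detRows {F : ℝ × (σ → ℝ) → σ → ℂ} {u : ℝ × (σ → ℝ) → ℂ}
    {φ : (σ → ℝ) → ℝ} (hφ : ContDiff ℝ 1 φ) (hc : HasCompactSupport φ)
    (hF : ∀ t, ∀ x ∈ tsupport φ, ContDiffAt ℝ 2 F (t, x))
    (hu : ∀ t, ∀ x ∈ tsupport φ, ContDiffAt ℝ 1 u (t, x))
    (hℓ : ∀ t, ∀ x ∈ tsupport φ, ∃ ℓ : (σ → ℂ) →ₗ[ℂ] ℂ,
      ∀ h, fderiv ℝ u (t, x) h = ℓ (fderiv ℝ F (t, x) h)) (t : ℝ) :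
    HasDerivAt (fun s => ∫ x, φ x • (u (s, x) * detRows σ (jacRows F spaceDir (s, x))))
      (-∫ x, ∑ j, fderiv ℝ φ x (Pi.single j 1) • fluxField F u (t, x) j) t := by
  set g : ℝ × (σ → ℝ) → ℂ := fun p => u p * detRows σ (jacRows F spaceDir p) with hg
  have hg1 : ∀ t, ∀ x ∈ tsupport φ, ContDiffAt ℝ 1 g (t, x) := fun t x hx =>
    (hu t x hx).mul (contDiffAt_detRows fun j => contDiffAt_fderiv_apply (hF t x hx) _)
  set h : ℝ × (σ → ℝ) → ℂ := fun p => φ p.2 • g p with hh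
  have hφ2 : ContDiff ℝ 1 fun p : ℝ × (σ → ℝ) => φ p.2 := hφ.comp contDiff_snd
  have hts : ∀ p : ℝ × (σ → ℝ), p ∈ tsupport h → p.2 ∈ tsupport φ := by
    intro p hp
    have h1 : tsupport h ⊆ tsupport fun p : ℝ × (σ → ℝ) => φ p.2 :=
      tsupport_smul_subset_left (fun p : ℝ × (σ → ℝ) => φ p.2) g
    exact tsupport_comp_subset_preimage φ continuous_snd (h1 hp)
  have hsm : ContDiff ℝ 1 h := by
    refine contDiff_of_contDiffAt_tsupport fun p hp => ?_
    exact hφ2.contDiffAt.smul (hg1 p.1 p.2 (hts p hp))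
  have hz : ∀ t, ∀ x ∉ tsupport φ, h (t, x) = 0 := fun t x hx => by
    simp [hh, image_eq_zero_of_notMem_tsupport hx]
  convert hasDerivAt_integral_of_contDiff hsm hc hz t using 1
  have hflux : ∀ j, ∀ x ∈ tsupport φ,
      ContDiffAt ℝ 1 (fun y => fluxField F u (t, y) j) x := fun j x hx =>
    (contDiffAt_fluxField (hF t x hx) (hu t x hx) j).comp x
      (contDiffAt_const.prodMk contDiffAt_id)
  have hpt : ∀ x, fderiv ℝ h (t, x) (1, 0) =
      ∑ j, φ x • fderiv ℝ (fun y => fluxField F u (t, y) j) x (Pi.single j 1) := by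
    intro x
    by_cases hx : x ∈ tsupport φ
    · have e1 : fderiv ℝ h (t, x) (1, 0) = φ x • fderiv ℝ g (t, x) (1, 0) := by
        have := (hφ2.differentiable (by norm_num) (t, x)).hasFDerivAt.smul
          ((hg1 t x hx).differentiableAt (by norm_num)).hasFDerivAt
        have e0 : fderiv ℝ h (t, x) = _ := this.fderiv
        rw [e0]
        have e2 : fderiv ℝ (fun p : ℝ × (σ → ℝ) => φ p.2) (t, x) (1, 0) = 0 := by
          have := ((hφ.differentiable (by norm_num) x).hasFDerivAt.comp (t, x)
            (hasFDerivAt_snd (𝕜 := ℝ) (E := ℝ) (F := σ → ℝ)))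
          rw [show (fun p : ℝ × (σ → ℝ) => φ p.2) = φ ∘ Prod.snd from rfl, this.fderiv]
          simp
        simp [e2]
      obtain ⟨ℓ, hℓ'⟩ := hℓ t x hx
      have e3 := fderiv_mul_detRows_jacRows (hF t x hx)
        ((hu t x hx).differentiableAt (by norm_num)) ℓ hℓ' spaceDir timeDir
      rw [e1, ← Finset.smul_sum]
      refine congrArg _ (e3.trans (Finset.sum_congr rfl fun j _ => ?_))
      have e4 := ((contDiffAt_fluxField (hF t x hx) (hu t x hx) j).differentiableAt
        (by norm_num)).hasFDerivAt.comp x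
        ((hasFDerivAt_const t x).prodMk (hasFDerivAt_id x))
      have e5 : fderiv ℝ (fun y => fluxField F u (t, y) j) x = _ := e4.fderiv
      rw [e5]
      simp [fluxField, spaceDir]
    · have : fderiv ℝ h (t, x) = 0 :=
        image_eq_zero_of_notMem_tsupport fun hp => hx (hts _ (tsupport_fderiv_subset ℝ hp))
      simp [this, image_eq_zero_of_notMem_tsupport hx]
  simp_rw [hpt]
  have hI : ∀ j, Integrable fun x => φ x •
      fderiv ℝ (fun y => fluxField F u (t, y) j) x (Pi.single j 1) := fun j =>
    integrable_smul_of_continuousAt hφ.continuous hc fun x hx =>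
      (((hflux j x hx).fderiv_right (m := 0) (by norm_num)).clm_apply
        contDiffAt_const).continuousAt
  have hI' : ∀ j, Integrable fun x => fderiv ℝ φ x (Pi.single j 1) • fluxField F u (t, x) j :=
    fun j => integrable_fderiv_smul_of_continuousAt hφ hc
      (fun x hx => (hflux j x hx).continuousAt) _
  rw [integral_finsetSum _ fun j _ => hI j, integral_finsetSum _ fun j _ => hI' j,
    ← Finset.sum_neg_distrib]
  refine Finset.sum_congr rfl fun j _ => ?_
  rw [integral_smul_fderiv_eq_neg_fderiv_smul_of_integrable (hI' j) (hI j)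
    (integrable_smul_of_continuousAt hφ.continuous hc fun x hx => (hflux j x hx).continuousAt)
    (fun x _ => hφ.differentiable (by norm_num) x)
    (fun x hx => (hflux j x hx).differentiableAt (by norm_num))]

end IntegralIdentities

section Unfolding

open MeasureTheory

variable {σ : Type*} [Fintype σ] [DecidableEq σ]

theorem abs_det_smul_integral_comp_mulVec {M : Matrix σ σ ℝ} (hM : M.det ≠ 0)
    {g : (σ → ℝ) → ℂ} (hg : Continuous g) :
    |M.det| • ∫ y, g (M *ᵥ y) = ∫ y, g y := by
  have hc : Continuous fun y => M *ᵥ y := continuous_const.matrix_mulVec continuous_id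
  have h := Real.map_matrix_volume_pi_eq_smul_volume_pi hM
  have h1 : ∫ y, g (M *ᵥ y) = ∫ y, g y ∂(Measure.map (toLin' M) volume) :=
    (integral_map (φ := fun y => M *ᵥ y) hc.aemeasurable hg.aestronglyMeasurable).symm
  rw [h1, h, integral_smul_measure, ENNReal.toReal_ofReal (abs_nonneg _), smul_smul, abs_inv,
    mul_inv_cancel₀ (abs_ne_zero.2 hM), one_smul]

/-- The complexified differential of `φ` at `x`. -/
def complexDiff (φ : (σ → ℝ) → ℝ) (x : σ → ℝ) (w : σ → ℂ) : ℂ :=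
  ∑ j, fderiv ℝ φ x (Pi.single j 1) • w j

theorem complexDiff_smul (φ : (σ → ℝ) → ℝ) (x : σ → ℝ) (c : ℝ) (w : σ → ℂ) :
    complexDiff φ x (c • w) = c • complexDiff φ x w := by
  simp only [complexDiff, Finset.smul_sum, Pi.smul_apply]
  exact Finset.sum_congr rfl fun j _ => smul_comm _ _ _

theorem complexDiff_comp_mulVec {φ : (σ → ℝ) → ℝ} (hφ : Differentiable ℝ φ) (M : Matrix σ σ ℝ)
    (x : σ → ℝ) (w : σ → ℂ) :
    complexDiff (fun y => φ (M *ᵥ y)) x w =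
      complexDiff φ (M *ᵥ x) (M.map Complex.ofReal *ᵥ w) := by
  have h : ∀ v, fderiv ℝ (fun y => φ (M *ᵥ y)) x v = fderiv ℝ φ (M *ᵥ x) (M *ᵥ v) := by
    intro v
    have h1 : HasFDerivAt (fun y => M *ᵥ y) (M.mulVecLin.toContinuousLinearMap) x :=
      M.mulVecLin.toContinuousLinearMap.hasFDerivAt
    have h2 := ((hφ (M *ᵥ x)).hasFDerivAt).comp x h1
    have h3 : fderiv ℝ (fun y => φ (M *ᵥ y)) x = _ := h2.fderiv
    rw [h3]
    rfl
  have h4 : ∀ j, fderiv ℝ φ (M *ᵥ x) (M *ᵥ Pi.single j 1) =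
      ∑ i, M i j * fderiv ℝ φ (M *ᵥ x) (Pi.single i 1) := by
    intro j
    have : M *ᵥ Pi.single j 1 = ∑ i, M i j • (Pi.single i 1 : σ → ℝ) := by
      ext k
      simp [Finset.sum_apply, Pi.single_apply]
    rw [this, map_sum]
    simp
  simp only [complexDiff, h, h4, Matrix.mulVec, dotProduct, Finset.smul_sum, Finset.sum_smul]
  rw [Finset.sum_comm]
  refine Finset.sum_congr rfl fun i _ => Finset.sum_congr rfl fun j _ => ?_
  simp only [Matrix.map_apply, Complex.real_smul]
  push_cast
  ring

theorem continuousAt_complexDiff {φ : (σ → ℝ) → ℝ} (hφ : ContDiff ℝ 1 φ)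
    {P : (σ → ℝ) → σ → ℂ} {x : σ → ℝ} (hP : ContinuousAt P x) :
    ContinuousAt (fun y => complexDiff φ y (P y)) x := by
  have h1 := continuousAt_pi.1 hP
  have h2 : ∀ j, ContinuousAt (fun y => fderiv ℝ φ y (Pi.single j 1) • P y j) x := fun j =>
    ((hφ.continuous_fderiv (by norm_num)).clm_apply continuous_const).continuousAt.smul (h1 j)
  unfold complexDiff
  exact tendsto_finsetSum _ fun j _ => h2 j

theorem complexDiff_sum_eq_zero {ι : Type*} {S : Finset ι} {g : ι → (σ → ℝ) → ℝ} {y : σ → ℝ}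
    (hd : ∀ γ ∈ S, DifferentiableAt ℝ (g γ) y)
    (h1 : ∀ᶠ z in nhds y, ∑ γ ∈ S, g γ z = 1) (w : σ → ℂ) :
    ∑ γ ∈ S, complexDiff (g γ) y w = 0 := by
  have hder : ∑ γ ∈ S, fderiv ℝ (g γ) y = 0 := by
    rw [← fderiv_fun_sum hd, Filter.EventuallyEq.fderiv_eq (f := fun _ => (1 : ℝ)) h1,
      fderiv_fun_const]
    rfl
  simp only [complexDiff]
  rw [Finset.sum_comm]
  refine Finset.sum_eq_zero fun j _ => ?_
  rw [← Finset.sum_smul]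
  have h2 := congrArg (fun L : (σ → ℝ) →L[ℝ] ℝ => L (Pi.single j 1)) hder
  have h3 : ∑ γ ∈ S, fderiv ℝ (g γ) y (Pi.single j 1) = 0 := by
    simpa [FunLike.coe_sum, Finset.sum_apply] using h2
  rw [h3, zero_smul]

/-- Unfolding: an equivariant vector field has zero total flux through an equivariant partition
of unity. -/
theorem integral_complexDiff_eq_zero {Λ : Type*} [Group Λ] (ρ : Λ →* Matrix σ σ ℝ)
    (hdet : ∀ γ, 0 < (ρ γ).det) {X : Set (σ → ℝ)}
    {φ : (σ → ℝ) → ℝ} (hφ : ContDiff ℝ 1 φ) (hc : HasCompactSupport φ) (hφX : tsupport φ ⊆ X)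
    {P : (σ → ℝ) → σ → ℂ} (hP : ∀ x ∈ X, ContinuousAt P x)
    (hPρ : ∀ γ, ∀ x ∈ X, (ρ γ).det • P (ρ γ *ᵥ x) = (ρ γ).map Complex.ofReal *ᵥ P x)
    (S : Finset Λ) (hSinv : ∀ γ ∈ S, γ⁻¹ ∈ S)
    (hS : ∀ x ∈ tsupport φ, ∑ γ ∈ S, φ (ρ γ *ᵥ x) = 1) :
    ∫ x, complexDiff φ x (P x) = 0 := by
  suffices h : ∀ a : (σ → ℝ) → ℂ, (∀ x, a x = complexDiff φ x (P x)) → ∫ x, a x = 0 from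
    h _ fun _ => rfl
  intro a ha
  have hmv : ∀ γ, Continuous fun x => ρ γ *ᵥ x := fun γ =>
    continuous_const.matrix_mulVec continuous_id
  have hcancel : ∀ γ (x : σ → ℝ), ρ γ *ᵥ (ρ γ⁻¹ *ᵥ x) = x := fun γ x => by
    rw [Matrix.mulVec_mulVec, ← map_mul, mul_inv_cancel, map_one, Matrix.one_mulVec]
  have haz : ∀ x ∉ tsupport φ, a x = 0 := fun x hx => by
    have : fderiv ℝ φ x = 0 :=
      image_eq_zero_of_notMem_tsupport fun hp => hx (tsupport_fderiv_subset ℝ hp)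
    simp [ha, complexDiff, this]
  have hats : tsupport a ⊆ tsupport φ :=
    closure_minimal (fun x hx => by_contra fun h => hx (haz x h)) (isClosed_tsupport φ)
  have hacont : Continuous a := by
    rw [funext ha]
    refine continuous_of_tsupport fun x hx => continuousAt_complexDiff hφ (hP x (hφX (hats ?_)))
    rwa [funext ha]
  have hacomp : HasCompactSupport a := hc.of_isClosed_subset (isClosed_tsupport a) hats
  have hdiff := hφ.differentiable (by norm_num)
  have ha_sum : ∀ x, a x = ∑ γ ∈ S, φ (ρ γ *ᵥ x) • a x := by
    intro x
    by_cases hx : x ∈ tsupport φ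
    · rw [← Finset.sum_smul, hS x hx, one_smul]
    · simp [haz x hx]
  have hcγ : ∀ γ, Continuous fun x => φ (ρ γ *ᵥ x) • a x := fun γ =>
    (hφ.continuous.comp (hmv γ)).smul hacont
  have h_term : ∀ γ, ∫ x, φ (ρ γ *ᵥ x) • a x =
      ∫ y, φ y • complexDiff (fun z => φ (ρ γ⁻¹ *ᵥ z)) y (P y) := by
    intro γ
    have hpt : ∀ y, (ρ γ⁻¹).det • (φ (ρ γ *ᵥ (ρ γ⁻¹ *ᵥ y)) • a (ρ γ⁻¹ *ᵥ y)) =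
        φ y • complexDiff (fun z => φ (ρ γ⁻¹ *ᵥ z)) y (P y) := by
      intro y
      rw [hcancel]
      by_cases hy : y ∈ tsupport φ
      · have h1 := complexDiff_comp_mulVec hdiff (ρ γ⁻¹) y (P y)
        have h2 := complexDiff_smul φ (ρ γ⁻¹ *ᵥ y) (ρ γ⁻¹).det (P (ρ γ⁻¹ *ᵥ y))
        rw [hPρ γ⁻¹ y (hφX hy)] at h2
        rw [smul_comm, h1, ha, h2]
      · rw [image_eq_zero_of_notMem_tsupport hy, zero_smul, zero_smul, smul_zero]
    have h3 := abs_det_smul_integral_comp_mulVec (hdet γ⁻¹).ne' (hcγ γ)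
    rw [← h3, abs_of_pos (hdet γ⁻¹), ← integral_smul, ← funext hpt]
  have hintegrable : ∀ γ, Integrable fun x => φ (ρ γ *ᵥ x) • a x := fun γ =>
    (hcγ γ).integrable_of_hasCompactSupport
      (HasCompactSupport.smul_left (f := fun x => φ (ρ γ *ᵥ x)) hacomp)
  have hcγ' : ∀ γ, Integrable fun y =>
      φ y • complexDiff (fun z => φ (ρ γ⁻¹ *ᵥ z)) y (P y) := by
    intro γ
    refine integrable_smul_of_continuousAt hφ.continuous hc fun x hx => ?_
    exact continuousAt_complexDiff
      (hφ.comp ((ρ γ⁻¹).mulVecLin.toContinuousLinearMap.contDiff)) (hP x (hφX hx))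
  calc ∫ x, a x = ∫ x, ∑ γ ∈ S, φ (ρ γ *ᵥ x) • a x := by simp_rw [← ha_sum]
    _ = ∑ γ ∈ S, ∫ y, φ y • complexDiff (fun z => φ (ρ γ⁻¹ *ᵥ z)) y (P y) := by
        rw [integral_finsetSum _ fun γ _ => hintegrable γ]
        exact Finset.sum_congr rfl fun γ _ => h_term γ
    _ = ∫ y, ∑ γ ∈ S, φ y • complexDiff (fun z => φ (ρ γ⁻¹ *ᵥ z)) y (P y) :=
        (integral_finsetSum _ fun γ _ => hcγ' γ).symm
    _ = ∫ y : σ → ℝ, (0 : ℂ) := by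
        refine integral_congr_ae (Filter.Eventually.of_forall fun y => ?_)
        by_cases hy : φ y = 0
        · simp [hy]
        have hnear : ∀ᶠ z in nhds y, ∑ γ ∈ S, φ (ρ γ⁻¹ *ᵥ z) = 1 := by
          filter_upwards [hφ.continuous.continuousAt.eventually_ne hy] with z hz
          rw [← hS z (subset_tsupport φ hz)]
          exact Finset.sum_nbij' (fun γ => γ⁻¹) (fun γ => γ⁻¹) hSinv hSinv
            (fun _ _ => inv_inv _) (fun _ _ => inv_inv _) (fun _ _ => rfl)
        have hd : ∀ γ ∈ S, DifferentiableAt ℝ (fun z => φ (ρ γ⁻¹ *ᵥ z)) y := fun γ _ =>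
          (hdiff.comp ((ρ γ⁻¹).mulVecLin.toContinuousLinearMap.differentiable)) y
        beta_reduce
        rw [← Finset.smul_sum, complexDiff_sum_eq_zero hd hnear, smul_zero]
    _ = 0 := by simp

end Unfolding

section Averages

open Topology

variable {σ : Type*} [Fintype σ]

/-- A compactly supported `C²` bump function equal to one near a given compact set. -/
theorem exists_contDiff_bump {C U : Set (σ → ℝ)} (hC : IsCompact C) (hU : IsOpen U) (hCU : C ⊆ U) :
    ∃ φ : (σ → ℝ) → ℝ, ContDiff ℝ 2 φ ∧ HasCompactSupport φ ∧ tsupport φ ⊆ U ∧ (∀ x, 0 ≤ φ x) ∧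
      ∀ᶠ x in 𝓝ˢ C, φ x = 1 := by
  obtain ⟨K, hK, hCK, hKU⟩ := exists_compact_between hC hU hCU
  obtain ⟨f, hf1, hf0, hf⟩ := exists_contMDiffMap_one_nhds_of_subset_interior
    (modelWithCornersSelf ℝ (σ → ℝ)) (n := 2) hC.isClosed hCK
  have hts : tsupport f ⊆ K :=
    closure_minimal (fun x hx => by_contra fun h => hx (hf0 x h)) hK.isClosed
  exact ⟨f, f.contMDiff.contDiff, hK.of_isClosed_subset (isClosed_tsupport _) hts,
    hts.trans hKU, fun x => (hf x).1, hf1⟩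

variable {Λ : Type*}

/-- The matrices `ρ γ` preserve `X`. -/
def PreservesSet (ρ : Λ → Matrix σ σ ℝ) (X : Set (σ → ℝ)) : Prop :=
  ∀ γ, ∀ x ∈ X, ρ γ *ᵥ x ∈ X

/-- The family `ρ` acts properly on `X`. -/
def ProperOn (ρ : Λ → Matrix σ σ ℝ) (X : Set (σ → ℝ)) : Prop :=
  ∀ K ⊆ X, IsCompact K → {γ | ∃ x ∈ K, ρ γ *ᵥ x ∈ K}.Finite

theorem ProperOn.exists_finset {ρ : Λ → Matrix σ σ ℝ} {X K L : Set (σ → ℝ)} (h : ProperOn ρ X)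
    (hK : IsCompact K) (hKX : K ⊆ X) (hL : IsCompact L) (hLX : L ⊆ X) :
    ∃ S : Finset Λ, ∀ γ, ∀ x ∈ K, ρ γ *ᵥ x ∈ L → γ ∈ S := by
  have hf := h (K ∪ L) (Set.union_subset hKX hLX) (hK.union hL)
  exact ⟨hf.toFinset, fun γ x hx hγ => hf.mem_toFinset.2 ⟨x, Or.inl hx, Or.inr hγ⟩⟩

variable {E : Type*} [NormedAddCommGroup E] [NormedSpace ℝ E]

/-- The weighted average of the family `c` with weights the translates of `φ`. -/
def orbitAverage (ρ : Λ → Matrix σ σ ℝ) (φ : (σ → ℝ) → ℝ) (c : Λ → E) (x : σ → ℝ) : E :=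
  ∑ᶠ γ, φ (ρ γ *ᵥ x) • c γ

theorem orbitAverage_eq_sum {ρ : Λ → Matrix σ σ ℝ} {X K : Set (σ → ℝ)} (h : ProperOn ρ X)
    (hK : IsCompact K) (hKX : K ⊆ X) {φ : (σ → ℝ) → ℝ} (hc : HasCompactSupport φ)
    (hφ : tsupport φ ⊆ X) (c : Λ → E) :
    ∃ S : Finset Λ, (∀ x ∈ K, ∀ γ, φ (ρ γ *ᵥ x) ≠ 0 → γ ∈ S) ∧
      ∀ x ∈ K, orbitAverage ρ φ c x = ∑ γ ∈ S, φ (ρ γ *ᵥ x) • c γ := by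
  obtain ⟨S, hS⟩ := h.exists_finset hK hKX hc hφ
  have h1 : ∀ x ∈ K, ∀ γ, φ (ρ γ *ᵥ x) ≠ 0 → γ ∈ S := fun x hx γ hγ =>
    hS γ x hx (subset_tsupport φ hγ)
  refine ⟨S, h1, fun x hx => finsum_eq_sum_of_support_subset _ fun γ hγ => h1 x hx γ fun h0 => ?_⟩
  simp [h0] at hγ

theorem contDiffAt_orbitAverage {ρ : Λ → Matrix σ σ ℝ} {X : Set (σ → ℝ)} (h : ProperOn ρ X)
    (hX : IsOpen X) {φ : (σ → ℝ) → ℝ} (hφ : ContDiff ℝ 2 φ) (hc : HasCompactSupport φ)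
    (hφX : tsupport φ ⊆ X) (c : Λ → E) {x : σ → ℝ} (hx : x ∈ X) :
    ContDiffAt ℝ 2 (orbitAverage ρ φ c) x := by
  obtain ⟨K, hK, hxK, hKX⟩ := exists_compact_subset hX hx
  obtain ⟨S, -, hS⟩ := orbitAverage_eq_sum h hK hKX hc hφX c
  have h1 : ContDiff ℝ 2 fun y => ∑ γ ∈ S, φ (ρ γ *ᵥ y) • c γ :=
    ContDiff.sum fun γ _ =>
      (hφ.comp ((ρ γ).mulVecLin.toContinuousLinearMap.contDiff)).smul contDiff_const
  refine h1.contDiffAt.congr_of_eventuallyEq ?_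
  filter_upwards [mem_interior_iff_mem_nhds.1 hxK] with y hy using hS y hy

theorem orbitAverage_mulVec [DecidableEq σ] [Group Λ] (ρ : Λ →* Matrix σ σ ℝ) {X : Set (σ → ℝ)}
    (h : ProperOn ρ X)
    {φ : (σ → ℝ) → ℝ} (hc : HasCompactSupport φ) (hφX : tsupport φ ⊆ X) {c : Λ → E} {γ : Λ}
    (L : E →ₗ[ℝ] E) (hL : ∀ δ, c (δ * γ⁻¹) = L (c δ)) {x : σ → ℝ} (hx : x ∈ X) :
    orbitAverage ρ φ c (ρ γ *ᵥ x) = L (orbitAverage ρ φ c x) := by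
  obtain ⟨S, hS, -⟩ := orbitAverage_eq_sum h isCompact_singleton
    (Set.singleton_subset_iff.2 hx) hc hφX c
  have hfin : (Function.support fun δ => φ (ρ δ *ᵥ x) • c δ).Finite :=
    S.finite_toSet.subset fun δ hδ => hS x rfl δ fun h0 => by simp [h0] at hδ
  unfold orbitAverage
  rw [map_finsum L hfin,
    ← finsum_comp_equiv (Equiv.mulRight γ⁻¹) (f := fun δ => φ (ρ δ *ᵥ (ρ γ *ᵥ x)) • c δ)]
  refine finsum_congr fun δ => ?_
  rw [LinearMap.map_smul, ← hL, Matrix.mulVec_mulVec, ← map_mul, Equiv.coe_mulRight,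
    inv_mul_cancel_right]

end Averages

section EquivariantMaps

open Topology

variable {σ : Type*} {X Y : Set (σ → ℝ)}

theorem finsum_mem_cone {ι : Type*} (hadd : ∀ y ∈ Y, ∀ z ∈ Y, y + z ∈ Y)
    (hsmul : ∀ r : ℝ, 0 < r → ∀ y ∈ Y, r • y ∈ Y) (S : Finset ι) (a : ι → ℝ) (ha : ∀ i, 0 ≤ a i)
    (hne : ∃ i ∈ S, a i ≠ 0) {y : ι → σ → ℝ} (hy : ∀ i, y i ∈ Y) : ∑ i ∈ S, a i • y i ∈ Y := by
  classical
  have h1 : ∑ i ∈ S, a i • y i = ∑ i ∈ S with a i ≠ 0, a i • y i := by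
    rw [Finset.sum_filter]
    refine Finset.sum_congr rfl fun i _ => ?_
    split_ifs with h
    · rfl
    · simp [not_not.1 h]
  rw [h1]
  obtain ⟨i, hi, hai⟩ := hne
  exact Finset.sum_induction_nonempty _ (· ∈ Y) (fun x z hx hz => hadd x hx z hz)
    ⟨i, Finset.mem_filter.2 ⟨hi, hai⟩⟩ fun j hj =>
      hsmul _ (lt_of_le_of_ne (ha j) (Finset.mem_filter.1 hj).2.symm) _ (hy j)

variable [Fintype σ] {Λ : Type*}

/-- A proper cocompact linear action on an open set maps equivariantly to every open convex cone
on which the group acts. -/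
theorem exists_equivariant_map [DecidableEq σ] [Group Λ] (ρ : Λ →* Matrix σ σ ℝ) (hX : IsOpen X)
    (hpX : ProperOn ρ X) (hρY : PreservesSet ρ Y)
    (hadd : ∀ y ∈ Y, ∀ z ∈ Y, y + z ∈ Y) (hsmul : ∀ r : ℝ, 0 < r → ∀ y ∈ Y, r • y ∈ Y)
    (hYne : Y.Nonempty) {C : Set (σ → ℝ)} (hC : IsCompact C) (hCX : C ⊆ X)
    (hcov : ∀ x ∈ X, ∃ γ, ρ γ *ᵥ x ∈ C) :
    ∃ m : (σ → ℝ) → σ → ℝ, (∀ x ∈ X, m x ∈ Y) ∧ (∀ x ∈ X, ContDiffAt ℝ 2 m x) ∧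
      ∀ γ, ∀ x ∈ X, m (ρ γ *ᵥ x) = ρ γ *ᵥ m x := by
  obtain ⟨y₁, hy₁⟩ := hYne
  obtain ⟨φ, hφ, hc, hφX, hφ0, hφ1⟩ := exists_contDiff_bump hC hX hCX
  refine ⟨orbitAverage ρ φ fun γ => ρ γ⁻¹ *ᵥ y₁, fun x hx => ?_, fun x hx =>
    contDiffAt_orbitAverage hpX hX hφ hc hφX _ hx, fun γ x hx => ?_⟩
  · obtain ⟨S, hS, hS'⟩ := orbitAverage_eq_sum hpX isCompact_singleton
      (Set.singleton_subset_iff.2 hx) hc hφX fun γ => ρ γ⁻¹ *ᵥ y₁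
    rw [hS' x rfl]
    obtain ⟨γ, hγ⟩ := hcov x hx
    have h1 : φ (ρ γ *ᵥ x) ≠ 0 := by
      rw [hφ1.self_of_nhdsSet _ hγ]
      exact one_ne_zero
    exact finsum_mem_cone hadd hsmul S (fun δ => φ (ρ δ *ᵥ x)) (fun _ => hφ0 _)
      ⟨γ, hS x rfl γ h1, h1⟩ fun δ => hρY δ⁻¹ _ hy₁
  · refine orbitAverage_mulVec ρ hpX hc hφX (ρ γ).mulVecLin (fun δ => ?_) hx
    rw [_root_.mul_inv_rev, inv_inv, map_mul, ← Matrix.mulVec_mulVec, Matrix.mulVecLin_apply]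

variable {C : Set (σ → ℝ)} {m : (σ → ℝ) → σ → ℝ}

theorem isCompact_inter_preimage [DecidableEq σ] [Group Λ] (ρ : Λ →* Matrix σ σ ℝ)
    (hρX : PreservesSet ρ X) (hpY : ProperOn ρ Y)
    (hC : IsCompact C) (hCX : C ⊆ X) (hcov : ∀ x ∈ X, ∃ γ, ρ γ *ᵥ x ∈ C)
    (hmY : ∀ x ∈ X, m x ∈ Y) (hmc : ContinuousOn m X)
    (hm : ∀ γ, ∀ x ∈ X, m (ρ γ *ᵥ x) = ρ γ *ᵥ m x) {B : Set (σ → ℝ)} (hB : IsCompact B)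
    (hBY : B ⊆ Y) : IsCompact (X ∩ m ⁻¹' B) := by
  have hmC : IsCompact (m '' C) := hC.image_of_continuousOn (hmc.mono hCX)
  obtain ⟨S, hS⟩ := hpY.exists_finset hB hBY hmC (Set.image_subset_iff.2 fun x hx => hmY x (hCX hx))
  set D : Set (σ → ℝ) := ⋃ γ ∈ S, (fun x => ρ γ⁻¹ *ᵥ x) '' C with hD
  have hDc : IsCompact D := S.isCompact_biUnion fun γ _ =>
    hC.image (continuous_const.matrix_mulVec continuous_id)
  have hDX : D ⊆ X := by
    intro x hx
    simp only [hD, Set.mem_iUnion] at hx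
    obtain ⟨γ, -, z, hz, rfl⟩ := hx
    exact hρX _ _ (hCX hz)
  have h1 : X ∩ m ⁻¹' B = D ∩ m ⁻¹' B := by
    refine Set.Subset.antisymm (fun x hx => ⟨?_, hx.2⟩) (fun x hx => ⟨hDX hx.1, hx.2⟩)
    obtain ⟨γ, hγ⟩ := hcov x hx.1
    refine Set.mem_biUnion (hS γ (m x) hx.2 ⟨_, hγ, hm γ x hx.1⟩) ⟨_, hγ, ?_⟩
    beta_reduce
    rw [Matrix.mulVec_mulVec, ← map_mul, inv_mul_cancel, map_one, Matrix.one_mulVec]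
  rw [h1]
  exact hDc.of_isClosed_subset
    ((hmc.mono hDX).preimage_isClosed_of_isClosed hDc.isClosed hB.isClosed) Set.inter_subset_left

/-- An equivariant map from a cocompact to a non-cocompact space misses a ball. -/
theorem exists_ball_disjoint_image [DecidableEq σ] [Group Λ] (ρ : Λ →* Matrix σ σ ℝ)
    (hρX : PreservesSet ρ X) (hpY : ProperOn ρ Y) (hY : IsOpen Y)
    (hC : IsCompact C) (hCX : C ⊆ X) (hcov : ∀ x ∈ X, ∃ γ, ρ γ *ᵥ x ∈ C)
    (hmY : ∀ x ∈ X, m x ∈ Y) (hmc : ContinuousOn m X)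
    (hm : ∀ γ, ∀ x ∈ X, m (ρ γ *ᵥ x) = ρ γ *ᵥ m x)
    (hncY : ∀ B ⊆ Y, IsCompact B → ∃ y ∈ Y, ∀ γ, ρ γ *ᵥ y ∉ B) :
    ∃ y ∈ Y, ∃ r > 0, ∀ x ∈ X, r ≤ dist (m x) y := by
  obtain ⟨y, hy, hyC⟩ := hncY (m '' C) (Set.image_subset_iff.2 fun x hx => hmY x (hCX hx))
    (hC.image_of_continuousOn (hmc.mono hCX))
  obtain ⟨K, hK, hyK, hKY⟩ := exists_compact_subset hY hy
  have h1 : IsCompact (m '' (X ∩ m ⁻¹' K)) :=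
    (isCompact_inter_preimage ρ hρX hpY hC hCX hcov hmY hmc hm hK hKY).image_of_continuousOn
      (hmc.mono Set.inter_subset_left)
  have h2 : y ∉ m '' (X ∩ m ⁻¹' K) := by
    rintro ⟨x, hx, rfl⟩
    obtain ⟨γ, hγ⟩ := hcov x hx.1
    exact hyC γ ⟨_, hγ, hm γ x hx.1⟩
  obtain ⟨r, hr, hball⟩ := Metric.mem_nhds_iff.1
    (Filter.inter_mem (h1.isClosed.isOpen_compl.mem_nhds h2) (mem_interior_iff_mem_nhds.1 hyK))
  refine ⟨y, hy, r, hr, fun x hx => not_lt.1 fun hlt => ?_⟩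
  exact (hball hlt).1 ⟨x, ⟨hx, (hball hlt).2⟩, rfl⟩

/-- A compactly supported weight whose translates sum to one along a given compact set's orbit. -/
theorem exists_partition_weight [DecidableEq σ] [Group Λ] (ρ : Λ →* Matrix σ σ ℝ)
    (hpY : ProperOn ρ Y) (hY : IsOpen Y) {B : Set (σ → ℝ)}
    (hB : IsCompact B) (hBY : B ⊆ Y) :
    ∃ ψ : (σ → ℝ) → ℝ, ContDiff ℝ 2 ψ ∧ HasCompactSupport ψ ∧ tsupport ψ ⊆ Y ∧ (∀ y, 0 ≤ ψ y) ∧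
      ∀ y ∈ Y, (∃ γ, ρ γ *ᵥ y ∈ B) → orbitAverage ρ ψ (fun _ => (1 : ℝ)) y = 1 := by
  obtain ⟨ψ₀, hψ, hc, hψY, h0, h1⟩ := exists_contDiff_bump hB hY hBY
  set s : (σ → ℝ) → ℝ := orbitAverage ρ ψ₀ fun _ => (1 : ℝ) with hs
  have hs0 : ∀ y, 0 ≤ s y := fun y => finsum_nonneg fun γ => by simpa using h0 _
  have hs1 : ∀ y ∈ Y, (∃ γ, ρ γ *ᵥ y ∈ B) → 1 ≤ s y := by
    rintro y hy ⟨γ, hγ⟩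
    obtain ⟨S, hS, hS'⟩ := orbitAverage_eq_sum hpY isCompact_singleton
      (Set.singleton_subset_iff.2 hy) hc hψY fun _ => (1 : ℝ)
    have h2 : ψ₀ (ρ γ *ᵥ y) = 1 := h1.self_of_nhdsSet _ hγ
    rw [hs, hS' y rfl]
    have h3 := Finset.single_le_sum (f := fun γ => ψ₀ (ρ γ *ᵥ y)) (fun δ _ => h0 _)
      (hS y rfl γ (by rw [h2]; exact one_ne_zero))
    simpa [h2] using h3
  have hsinv : ∀ γ, ∀ y ∈ Y, s (ρ γ *ᵥ y) = s y := fun γ y hy =>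
    orbitAverage_mulVec ρ hpY hc hψY LinearMap.id (fun _ => rfl) hy
  have hd : ∀ y, 0 < s y + 1 - Real.smoothTransition (s y) := by
    intro y
    rcases (hs0 y).eq_or_lt with h | h
    · simp [← h]
    · linarith [Real.smoothTransition.le_one (s y)]
  set ψ : (σ → ℝ) → ℝ := fun y => ψ₀ y / (s y + 1 - Real.smoothTransition (s y)) with hψdef
  have hts : tsupport ψ ⊆ tsupport ψ₀ :=
    closure_mono fun y hy h => hy (by simp [hψdef, h])
  refine ⟨ψ, contDiff_of_contDiffAt_tsupport fun y hy => ?_,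
    hc.of_isClosed_subset (isClosed_tsupport _) hts, hts.trans hψY,
    fun y => div_nonneg (h0 y) (hd y).le, fun y hy hγ => ?_⟩
  · have h2 : ContDiffAt ℝ 2 s y := contDiffAt_orbitAverage hpY hY hψ hc hψY _ (hψY (hts hy))
    refine hψ.contDiffAt.div ((h2.add contDiffAt_const).sub ?_) (hd y).ne'
    exact (Real.smoothTransition.contDiffAt (n := 2)).comp y h2
  · have h2 : ∀ γ, ψ (ρ γ *ᵥ y) • (1 : ℝ) = (s y)⁻¹ • (ψ₀ (ρ γ *ᵥ y) • (1 : ℝ)) := by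
      intro γ
      simp only [hψdef, hsinv γ y hy, smul_eq_mul, mul_one,
        Real.smoothTransition.one_of_one_le (hs1 y hy hγ), add_sub_cancel_right]
      rw [div_eq_inv_mul]
    rw [orbitAverage, finsum_congr h2, ← smul_finsum]
    exact inv_mul_cancel₀ (zero_lt_one.trans_le (hs1 y hy hγ)).ne'

end EquivariantMaps

/-- The inclusion of `ℝ^σ` in `ℂ^σ`. -/
def complexify (σ : Type*) : (σ → ℝ) →L[ℝ] σ → ℂ :=
  ContinuousLinearMap.pi fun i => Complex.ofRealCLM.comp (ContinuousLinearMap.proj i)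

theorem complexify_apply {σ : Type*} (x : σ → ℝ) (i : σ) : complexify σ x i = (x i : ℂ) := rfl

theorem complexify_mulVec {σ : Type*} [Fintype σ] (M : Matrix σ σ ℝ) (x : σ → ℝ) :
    complexify σ (M *ᵥ x) = M.map Complex.ofReal *ᵥ complexify σ x := by
  ext i
  simp [complexify_apply, Matrix.mulVec, dotProduct]

section Homotopies

open Topology MeasureTheory

variable {σ : Type*} [Fintype σ] [DecidableEq σ]

theorem fluxField_eq (F : ℝ × (σ → ℝ) → σ → ℂ) (u : ℝ × (σ → ℝ) → ℂ) (p : ℝ × (σ → ℝ)) :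
    fluxField F u p =
      u p • ((Matrix.of (jacRows F spaceDir p))ᵀ.adjugate *ᵥ fderiv ℝ F p timeDir) := by
  ext j
  rw [← cramer_eq_adjugate_mulVec, Pi.smul_apply, cramer_transpose_apply, fluxField, detRows_apply]
  rfl

/-- The flux field of an equivariant deformation is equivariant. -/
theorem fluxField_mulVec {F : ℝ × (σ → ℝ) → σ → ℂ} {u : ℝ × (σ → ℝ) → ℂ} {M : Matrix σ σ ℝ}
    (hM : M.det ≠ 0) {t : ℝ} {x : σ → ℝ} (hF : DifferentiableAt ℝ F (t, x))
    (hF' : DifferentiableAt ℝ F (t, M *ᵥ x))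
    (heq : ∀ᶠ p in 𝓝 (t, x), F (p.1, M *ᵥ p.2) = M.map Complex.ofReal *ᵥ F p)
    (hu : M.det • u (t, M *ᵥ x) = u (t, x)) :
    M.det • fluxField F u (t, M *ᵥ x) = M.map Complex.ofReal *ᵥ fluxField F u (t, x) := by
  set Mc : Matrix σ σ ℂ := M.map Complex.ofReal with hMc
  have hdet : Mc.det = (M.det : ℂ) := (Complex.ofRealHom.map_det M).symm
  set L : ℝ × (σ → ℝ) →L[ℝ] ℝ × (σ → ℝ) :=
    (ContinuousLinearMap.fst ℝ ℝ (σ → ℝ)).prod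
      (M.mulVecLin.toContinuousLinearMap.comp (ContinuousLinearMap.snd ℝ ℝ (σ → ℝ))) with hL
  set N : (σ → ℂ) →L[ℝ] σ → ℂ := (Mc.mulVecLin.restrictScalars ℝ).toContinuousLinearMap with hN
  have hNa : ∀ v, N v = Mc *ᵥ v := fun v => rfl
  have hder : ∀ h, fderiv ℝ F (t, M *ᵥ x) (L h) = Mc *ᵥ fderiv ℝ F (t, x) h := by
    intro h
    have h1 : HasFDerivAt (fun p => F (L p)) ((fderiv ℝ F (t, M *ᵥ x)).comp L) (t, x) :=
      HasFDerivAt.comp (t, x) (f := L) (g := F) hF'.hasFDerivAt L.hasFDerivAt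
    have h2 : HasFDerivAt (fun p => N (F p)) (N.comp (fderiv ℝ F (t, x))) (t, x) :=
      N.hasFDerivAt.comp (t, x) hF.hasFDerivAt
    have h3 := h1.unique (h2.congr_of_eventuallyEq heq)
    exact congrArg (fun T : ℝ × (σ → ℝ) →L[ℝ] σ → ℂ => T h) h3
  set A := (Matrix.of (jacRows F spaceDir (t, x)))ᵀ with hA
  set A' := (Matrix.of (jacRows F spaceDir (t, M *ᵥ x)))ᵀ with hA'
  have htime : fderiv ℝ F (t, M *ᵥ x) timeDir = Mc *ᵥ fderiv ℝ F (t, x) timeDir := by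
    rw [← hder]
    congr 1
    simp [hL, timeDir]
  have hspace : A' * Mc = Mc * A := by
    ext i j
    have h1 : L (spaceDir j) = ∑ k, M k j • (spaceDir k : ℝ × (σ → ℝ)) := by
      have h2 : M *ᵥ Pi.single j 1 = ∑ k, M k j • (Pi.single k 1 : σ → ℝ) := by
        ext k
        simp [Finset.sum_apply, Pi.single_apply]
      refine Prod.ext ?_ ?_
      · simp [hL, spaceDir, Prod.fst_sum]
      · rw [Prod.snd_sum]
        exact h2
    have h3 := hder (spaceDir j)
    rw [h1, map_sum] at h3
    have h4 := congrFun h3 i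
    simp only [map_smul, Finset.sum_apply, Pi.smul_apply] at h4
    rw [Matrix.mul_apply, Matrix.mul_apply]
    refine Eq.trans (Finset.sum_congr rfl fun k _ => ?_) (h4.trans rfl)
    rw [Complex.real_smul, mul_comm]
    rfl
  have hMd : Mc.det ≠ 0 := by rw [hdet]; exact_mod_cast hM
  have hadj : A'.adjugate *ᵥ (Mc *ᵥ fderiv ℝ F (t, x) timeDir) =
      Mc *ᵥ (A.adjugate *ᵥ fderiv ℝ F (t, x) timeDir) := by
    have h1 : Mc.adjugate * A'.adjugate = A.adjugate * Mc.adjugate := by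
      rw [← adjugate_mul_distrib, hspace, adjugate_mul_distrib]
    have h2 : Mc.det • (A'.adjugate * Mc) = Mc.det • (Mc * A.adjugate) := by
      calc Mc.det • (A'.adjugate * Mc) = (Mc * Mc.adjugate) * A'.adjugate * Mc := by
            rw [mul_adjugate]; simp
        _ = Mc * (Mc.adjugate * A'.adjugate) * Mc := by simp only [Matrix.mul_assoc]
        _ = Mc * A.adjugate * (Mc.adjugate * Mc) := by rw [h1]; simp only [Matrix.mul_assoc]
        _ = _ := by rw [adjugate_mul]; simp
    rw [Matrix.mulVec_mulVec, Matrix.mulVec_mulVec, smul_right_injective _ hMd h2]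
  rw [fluxField_eq, fluxField_eq, htime, ← hA, ← hA', hadj, Matrix.mulVec_smul, ← smul_assoc, hu]

theorem eq_of_hasDerivAt_zero {I : ℝ → ℂ} (h : ∀ t, HasDerivAt I 0 t) (s t : ℝ) : I s = I t :=
  is_const_of_deriv_eq_zero (fun t => (h t).differentiableAt) (fun t => (h t).deriv) s t

/-- Equivariant deformations do not change the integral over a fundamental domain of the
pull-back of a holomorphic top degree form. -/
theorem integral_detRows_eq_of_equivariant {Λ : Type*} [Group Λ] (ρ : Λ →* Matrix σ σ ℝ)
    (hdet : ∀ γ, 0 < (ρ γ).det) {X : Set (σ → ℝ)} (hX : IsOpen X) (hρX : PreservesSet ρ X)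
    {φ : (σ → ℝ) → ℝ} (hφ : ContDiff ℝ 1 φ) (hc : HasCompactSupport φ) (hφX : tsupport φ ⊆ X)
    {F : ℝ × (σ → ℝ) → σ → ℂ} {u : ℝ × (σ → ℝ) → ℂ}
    (hF : ∀ t, ∀ x ∈ X, ContDiffAt ℝ 2 F (t, x)) (hu : ∀ t, ∀ x ∈ X, ContDiffAt ℝ 1 u (t, x))
    (hℓ : ∀ t, ∀ x ∈ X, ∃ ℓ : (σ → ℂ) →ₗ[ℂ] ℂ, ∀ h, fderiv ℝ u (t, x) h = ℓ (fderiv ℝ F (t, x) h))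
    (hFρ : ∀ γ, ∀ t, ∀ x ∈ X, F (t, ρ γ *ᵥ x) = (ρ γ).map Complex.ofReal *ᵥ F (t, x))
    (huρ : ∀ γ, ∀ t, ∀ x ∈ X, (ρ γ).det • u (t, ρ γ *ᵥ x) = u (t, x))
    (S : Finset Λ) (hSinv : ∀ γ ∈ S, γ⁻¹ ∈ S)
    (hS : ∀ x ∈ tsupport φ, ∑ γ ∈ S, φ (ρ γ *ᵥ x) = 1) (s t : ℝ) :
    ∫ x, φ x • (u (s, x) * detRows σ (jacRows F spaceDir (s, x))) =
      ∫ x, φ x • (u (t, x) * detRows σ (jacRows F spaceDir (t, x))) := by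
  refine eq_of_hasDerivAt_zero
    (I := fun s => ∫ x, φ x • (u (s, x) * detRows σ (jacRows F spaceDir (s, x)))) (fun t => ?_) s t
  have h1 := hasDerivAt_integral_smul_mul_detRows hφ hc (fun t x hx => hF t x (hφX hx))
    (fun t x hx => hu t x (hφX hx)) (fun t x hx => hℓ t x (hφX hx)) t
  have h2 : ∫ x, complexDiff φ x (fluxField F u (t, x)) = 0 := by
    refine integral_complexDiff_eq_zero ρ hdet hφ hc hφX (P := fun x => fluxField F u (t, x))
      (fun x hx => ?_) (fun γ x hx => ?_) S hSinv hS
    · refine continuousAt_pi.2 fun j => ?_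
      exact ((contDiffAt_fluxField (hF t x hx) (hu t x hx) j).continuousAt).comp
        (f := fun x => (t, x)) (by fun_prop)
    · refine fluxField_mulVec (hdet γ).ne' ((hF t x hx).differentiableAt (by norm_num))
        ((hF t _ (hρX γ x hx)).differentiableAt (by norm_num)) ?_ (huρ γ t x hx)
      filter_upwards [continuousAt_snd.eventually (hX.mem_nhds hx)] with p hp
      exact hFρ γ p.1 p.2 hp
  have h3 : ∫ x, ∑ j, fderiv ℝ φ x (Pi.single j 1) • fluxField F u (t, x) j = 0 := h2
  rwa [h3, neg_zero] at h1

/-- The rows of the Jacobian matrix of a real map. -/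
def realJacRows (m : (σ → ℝ) → σ → ℝ) (x : σ → ℝ) : σ → σ → ℂ :=
  fun j => complexify σ (fderiv ℝ m x (Pi.single j 1))

/-- A compactly supported top degree form has zero pull-back integral along a map which misses a
ball in a convex domain. -/
theorem integral_detRows_eq_zero_of_ball_disjoint {X Y : Set (σ → ℝ)} (hX : IsOpen X)
    (hY : Convex ℝ Y) {m : (σ → ℝ) → σ → ℝ} (hm : ∀ x ∈ X, ContDiffAt ℝ 2 m x)
    (hcpt : ∀ B ⊆ Y, IsCompact B → IsCompact (X ∩ m ⁻¹' B))
    {y₀ : σ → ℝ} (hy₀ : y₀ ∈ Y) {r : ℝ} (hr : 0 < r) (hmiss : ∀ x ∈ X, r ≤ dist (m x) y₀)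
    {G : (σ → ℝ) → ℂ} (hG : ContDiff ℝ 1 G) (hGc : HasCompactSupport G) (hGY : tsupport G ⊆ Y) :
    ∃ φ : (σ → ℝ) → ℝ, tsupport φ ⊆ X ∧ (∀ x ∈ X, G (m x) ≠ 0 → φ x = 1) ∧
      ∫ x, φ x • (G (m x) * detRows σ (realJacRows m x)) = 0 := by
  set B : Set (σ → ℝ) := (fun p : ℝ × (σ → ℝ) => y₀ + p.1 • (p.2 - y₀)) ''
    (Set.Icc (0 : ℝ) 1 ×ˢ tsupport G) with hB
  have hBc : IsCompact B := (isCompact_Icc.prod hGc).image (by fun_prop)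
  have hBY : B ⊆ Y := by
    rintro _ ⟨⟨a, y⟩, ⟨ha, hy⟩, rfl⟩
    exact hY.add_smul_sub_mem hy₀ (hGY hy) ha
  obtain ⟨φ, hφ, hφc, hφX, -, hφ1⟩ := exists_contDiff_bump (hcpt B hBY hBc) hX
    Set.inter_subset_left
  set f : ℝ × (σ → ℝ) → σ → ℝ := fun p => y₀ + (1 + p.1 ^ 2) • (m p.2 - y₀) with hf
  have hf2 : ∀ t, ∀ x ∈ X, ContDiffAt ℝ 2 f (t, x) := by
    intro t x hx
    have h1 : ContDiffAt ℝ 2 (fun p : ℝ × (σ → ℝ) => m p.2) (t, x) :=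
      ContDiffAt.comp (t, x) (f := Prod.snd) (g := m) (hm x hx) contDiffAt_snd
    have h2 : ContDiffAt ℝ 2 (fun p : ℝ × (σ → ℝ) => 1 + p.1 ^ 2) (t, x) := by fun_prop
    exact contDiffAt_const.add (h2.smul (h1.sub contDiffAt_const))
  have hfB : ∀ t, ∀ x ∈ X, G (f (t, x)) ≠ 0 → x ∈ X ∩ m ⁻¹' B := by
    intro t x hx h
    have hp : (0 : ℝ) < 1 + t ^ 2 := by positivity
    refine ⟨hx, ⟨((1 + t ^ 2)⁻¹, f (t, x)), ⟨⟨by positivity, inv_le_one_of_one_le₀ ?_⟩,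
      subset_tsupport G h⟩, ?_⟩⟩
    · nlinarith [sq_nonneg t]
    · simp only [hf, add_sub_cancel_left, smul_smul, inv_mul_cancel₀ hp.ne', one_smul]
      exact add_sub_cancel _ _
  set F : ℝ × (σ → ℝ) → σ → ℂ := fun p => complexify σ (f p) with hF
  have hFd : ∀ t, ∀ x ∈ X, ∀ h, fderiv ℝ F (t, x) h = complexify σ (fderiv ℝ f (t, x) h) := by
    intro t x hx h
    have h1 : HasFDerivAt F ((complexify σ).comp (fderiv ℝ f (t, x))) (t, x) :=
      (complexify σ).hasFDerivAt.comp (t, x)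
        ((hf2 t x hx).differentiableAt (by norm_num)).hasFDerivAt
    rw [h1.fderiv]
    rfl
  have hder := hasDerivAt_integral_smul_mul_detRows (F := F) (u := fun p => G (f p))
    (hφ.of_le (by norm_num)) hφc
    (fun t x hx => (complexify σ).contDiff.contDiffAt.comp (t, x) (hf2 t x (hφX hx)))
    (fun t x hx => hG.contDiffAt.comp (t, x) ((hf2 t x (hφX hx)).of_le (by norm_num)))
    (fun t x hx => ⟨∑ j, fderiv ℝ G (f (t, x)) (Pi.single j 1) • LinearMap.proj j, fun h => by
      have h1 : HasFDerivAt (fun p => G (f p)) ((fderiv ℝ G (f (t, x))).comp (fderiv ℝ f (t, x)))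
          (t, x) :=
        ((hG.differentiable (by norm_num)) _).hasFDerivAt.comp (t, x)
          ((hf2 t x (hφX hx)).differentiableAt (by norm_num)).hasFDerivAt
      rw [h1.fderiv, hFd t x (hφX hx)]
      rw [ContinuousLinearMap.comp_apply]
      conv_lhs => rw [← Finset.univ_sum_single (fderiv ℝ f (t, x) h)]
      simp only [map_sum, LinearMap.sum_apply, LinearMap.smul_apply, LinearMap.proj_apply,
        complexify_apply, smul_eq_mul]
      refine Finset.sum_congr rfl fun j _ => ?_
      have h2 : (Pi.single j (fderiv ℝ f (t, x) h j) : σ → ℝ) =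
          fderiv ℝ f (t, x) h j • Pi.single j 1 := by
        rw [← Pi.single_smul, smul_eq_mul, mul_one]
      rw [h2, map_smul, Complex.real_smul, mul_comm]⟩)
  set I : ℝ → ℂ := fun s => ∫ x, φ x • (G (f (s, x)) * detRows σ (jacRows F spaceDir (s, x)))
    with hI
  have hI0 : ∀ t, HasDerivAt I 0 t := by
    intro t
    have h1 := hder t
    have h2 : ∀ x, ∑ j, fderiv ℝ φ x (Pi.single j 1) • fluxField F (fun p => G (f p)) (t, x) j
        = 0 := by
      intro x
      refine Finset.sum_eq_zero fun j _ => ?_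
      by_cases hx : x ∈ X
      · by_cases h : G (f (t, x)) = 0
        · simp [fluxField, h]
        · have h3 : fderiv ℝ φ x = 0 := by
            have h4 : φ =ᶠ[𝓝 x] fun _ => 1 :=
              Filter.eventually_of_mem (U := {x | φ x = 1})
                (mem_nhdsSet_iff_forall.1 hφ1 x (hfB t x hx h)) fun _ h => h
            rw [h4.fderiv_eq, fderiv_fun_const]
            rfl
          simp [h3]
      · have h3 : fderiv ℝ φ x = 0 :=
          image_eq_zero_of_notMem_tsupport fun hp => hx (hφX (tsupport_fderiv_subset ℝ hp))
        simp [h3]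
    simp_rw [h2] at h1
    simpa using h1
  have hI1 : I 0 = ∫ x, φ x • (G (m x) * detRows σ (realJacRows m x)) := by
    refine congrArg (fun f : (σ → ℝ) → ℂ => ∫ x, f x) (funext fun x => ?_)
    by_cases hx : x ∈ X
    · have h1 : f (0, x) = m x := by simp [hf]
      have h2 : jacRows F spaceDir (0, x) = realJacRows m x := by
        funext j
        rw [jacRows, hFd 0 x hx, realJacRows]
        congr 1
        have h3 : HasFDerivAt (fun z : σ → ℝ => f (0, z)) ((fderiv ℝ f (0, x)).comp
            (ContinuousLinearMap.inr ℝ ℝ (σ → ℝ))) x :=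
          HasFDerivAt.comp x (f := fun z : σ → ℝ => ((0 : ℝ), z)) (g := f)
            ((hf2 0 x hx).differentiableAt (by norm_num)).hasFDerivAt (hasFDerivAt_prodMk_right _ _)
        have h4 : (fun z : σ → ℝ => f (0, z)) = m := by
          funext z
          simp [hf]
        rw [h4] at h3
        rw [h3.fderiv]
        rfl
      rw [h1, h2]
    · rw [image_eq_zero_of_notMem_tsupport fun h => hx (hφX h), zero_smul, zero_smul]
  obtain ⟨R, hR⟩ := hGc.isBounded.subset_closedBall y₀
  obtain ⟨T, hT⟩ : ∃ T : ℝ, R < (1 + T ^ 2) * r := by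
    refine ⟨max R 1 / r + 1, ?_⟩
    have h1 : 0 < max R 1 / r := by positivity
    have h2 : max R 1 / r * r = max R 1 := div_mul_cancel₀ _ hr.ne'
    nlinarith [le_max_left R 1, mul_pos h1 hr, mul_pos (mul_pos h1 h1) hr]
  have hIT : I T = 0 := by
    refine (integral_congr_ae (Filter.Eventually.of_forall fun x => ?_)).trans (integral_zero _ _)
    by_cases hx : x ∈ X
    · have h1 : G (f (T, x)) = 0 := by
        by_contra h
        have h2 := hR (subset_tsupport G h)
        rw [Metric.mem_closedBall, dist_eq_norm] at h2
        have h3 : f (T, x) - y₀ = (1 + T ^ 2) • (m x - y₀) := by simp [hf]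
        rw [h3, norm_smul, Real.norm_of_nonneg (by positivity), ← dist_eq_norm] at h2
        have h4 := mul_le_mul_of_nonneg_left (hmiss x hx) (show 0 ≤ 1 + T ^ 2 by positivity)
        linarith
      simp [h1]
    · simp [image_eq_zero_of_notMem_tsupport fun h => hx (hφX h)]
  refine ⟨φ, hφX, fun x hx h => ?_, ?_⟩
  · refine hφ1.self_of_nhdsSet _ (hfB 0 x hx ?_)
    simpa [hf] using h
  · rw [← hI1, eq_of_hasDerivAt_zero hI0 0 T, hIT]

end Homotopies

section Obstruction

open Topology MeasureTheory

theorem convex_of_add_mem_of_smul_mem {E : Type*} [AddCommGroup E] [Module ℝ E] {Y : Set E}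
    (hadd : ∀ y ∈ Y, ∀ z ∈ Y, y + z ∈ Y)
    (hsmul : ∀ r : ℝ, 0 < r → ∀ y ∈ Y, r • y ∈ Y) : Convex ℝ Y := by
  intro x hx y hy a b ha hb hab
  rcases ha.eq_or_lt with rfl | ha
  · obtain rfl : b = 1 := by linarith
    simpa using hy
  rcases hb.eq_or_lt with rfl | hb
  · obtain rfl : a = 1 := by linarith
    simpa using hx
  exact hadd _ (hsmul a ha x hx) _ (hsmul b hb y hy)

variable {σ : Type*}

/-- The straight-line homotopy from the inclusion `ℝ^σ ⊆ ℂ^σ` to `i • m`. -/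
def rotationHomotopy (m : (σ → ℝ) → σ → ℝ) (p : ℝ × (σ → ℝ)) : σ → ℂ :=
  (1 - p.1) • complexify σ p.2 + p.1 • (Complex.I • complexify σ (m p.2))

variable [Fintype σ]

theorem contDiffAt_rotationHomotopy {m : (σ → ℝ) → σ → ℝ} {x : σ → ℝ} (hm : ContDiffAt ℝ 2 m x)
    (t : ℝ) : ContDiffAt ℝ 2 (rotationHomotopy m) (t, x) := by
  have h1 : ContDiffAt ℝ 2 (fun p : ℝ × (σ → ℝ) => complexify σ (m p.2)) (t, x) :=
    (complexify σ).contDiff.contDiffAt.comp (t, x)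
      (ContDiffAt.comp (t, x) (f := Prod.snd) (g := m) hm contDiffAt_snd)
  have h2 : ContDiffAt ℝ 2 (fun p : ℝ × (σ → ℝ) => complexify σ p.2) (t, x) :=
    (complexify σ).contDiff.contDiffAt.comp (t, x) contDiffAt_snd
  have h3 : ContDiffAt ℝ 2 (fun p : ℝ × (σ → ℝ) => p.1) (t, x) := contDiffAt_fst
  exact ((contDiffAt_const.sub h3).smul h2).add (h3.smul (h1.const_smul Complex.I))

theorem rotationHomotopy_mulVec {m : (σ → ℝ) → σ → ℝ} {M : Matrix σ σ ℝ} {x : σ → ℝ}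
    (hm : m (M *ᵥ x) = M *ᵥ m x) (t : ℝ) :
    rotationHomotopy m (t, M *ᵥ x) = M.map Complex.ofReal *ᵥ rotationHomotopy m (t, x) := by
  simp only [rotationHomotopy, hm, complexify_mulVec, Matrix.mulVec_add, Matrix.mulVec_smul]

variable [DecidableEq σ]

theorem fderiv_rotationHomotopy_spaceDir {m : (σ → ℝ) → σ → ℝ} {x : σ → ℝ}
    (hm : ContDiffAt ℝ 2 m x) (t : ℝ) (j : σ) :
    fderiv ℝ (rotationHomotopy m) (t, x) (spaceDir j) =
      (1 - t) • complexify σ (Pi.single j 1) + t • (Complex.I • realJacRows m x j) := by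
  have h1 : HasFDerivAt (fun z : σ → ℝ => rotationHomotopy m (t, z))
      ((fderiv ℝ (rotationHomotopy m) (t, x)).comp (ContinuousLinearMap.inr ℝ ℝ (σ → ℝ))) x :=
    HasFDerivAt.comp x (f := fun z : σ → ℝ => (t, z)) (g := rotationHomotopy m)
      ((contDiffAt_rotationHomotopy hm t).differentiableAt (by norm_num)).hasFDerivAt
      (hasFDerivAt_prodMk_right _ _)
  have h2 : HasFDerivAt (fun z : σ → ℝ => rotationHomotopy m (t, z))
      ((1 - t) • complexify σ +
        t • (Complex.I • (complexify σ).comp (fderiv ℝ m x))) x :=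
    ((complexify σ).hasFDerivAt.const_smul (1 - t)).add
      ((((complexify σ).hasFDerivAt.comp x
        (hm.differentiableAt (by norm_num)).hasFDerivAt).const_smul Complex.I).const_smul t)
  exact congrArg (fun T : (σ → ℝ) →L[ℝ] σ → ℂ => T (Pi.single j 1)) (h1.unique h2)

theorem detRows_complexify_single : detRows σ (fun j => complexify σ (Pi.single j 1)) = 1 := by
  rw [detRows_apply, ← Matrix.det_one (n := σ) (R := ℂ)]
  congr 1
  ext i j
  simp only [Matrix.of_apply, complexify_apply, Pi.single_apply, Matrix.one_apply, eq_comm]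
  split_ifs <;> simp

/-- A group acting linearly, properly and cocompactly on a nonempty open set `X` cannot act
properly but not cocompactly on an open convex cone `Y`, when there is an invariant holomorphic
top degree form near the segments joining `X` to `i • Y` which has constant phase on `X`. -/
theorem false_of_proper_cocompact {Λ : Type*} [Group Λ] (ρ : Λ →* Matrix σ σ ℝ)
    (hdet : ∀ γ, 0 < (ρ γ).det) {X Y : Set (σ → ℝ)}
    (hX : IsOpen X) (hXne : X.Nonempty) (hρX : PreservesSet ρ X) (hpX : ProperOn ρ X)
    (hY : IsOpen Y) (hYne : Y.Nonempty) (hρY : PreservesSet ρ Y) (hpY : ProperOn ρ Y)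
    (hadd : ∀ y ∈ Y, ∀ z ∈ Y, y + z ∈ Y) (hsmul : ∀ r : ℝ, 0 < r → ∀ y ∈ Y, r • y ∈ Y)
    (hcX : ∃ C ⊆ X, IsCompact C ∧ ∀ x ∈ X, ∃ γ, ρ γ *ᵥ x ∈ C)
    (hncY : ∀ B ⊆ Y, IsCompact B → ∃ y ∈ Y, ∀ γ, ρ γ *ᵥ y ∉ B)
    {w : (σ → ℂ) → ℂ}
    (hw : ∀ x ∈ X, ∀ y ∈ Y, ∀ t : ℝ,
      ContDiffAt ℂ 1 w ((1 - t) • complexify σ x + t • (Complex.I • complexify σ y)))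
    (hwρ : ∀ γ z, (ρ γ).det • w ((ρ γ).map Complex.ofReal *ᵥ z) = w z)
    (hpos : ∃ c : ℂ, ∀ x ∈ X, 0 < (c * w (complexify σ x)).re) : False := by
  obtain ⟨C, hCX, hC, hcov⟩ := hcX
  obtain ⟨c, hpos⟩ := hpos
  obtain ⟨m, hmY, hm2, hmρ⟩ :=
    exists_equivariant_map ρ hX hpX hρY hadd hsmul hYne hC hCX hcov
  have hmc : ContinuousOn m X := fun x hx => (hm2 x hx).continuousAt.continuousWithinAt
  obtain ⟨y₀, hy₀, r, hr, hmiss⟩ :=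
    exists_ball_disjoint_image ρ hρX hpY hY hC hCX hcov hmY hmc hmρ hncY
  have hcpt : ∀ B ⊆ Y, IsCompact B → IsCompact (X ∩ m ⁻¹' B) := fun B hBY hB =>
    isCompact_inter_preimage ρ hρX hpY hC hCX hcov hmY hmc hmρ hB hBY
  obtain ⟨ψ, hψ, hψc, hψY, hψ0, hψ1⟩ := exists_partition_weight ρ hpY hY
    (hC.image_of_continuousOn (hmc.mono hCX)) (Set.image_subset_iff.2 fun x hx => hmY x (hCX hx))
  have hψsum : ∀ x ∈ X, orbitAverage ρ ψ (fun _ => (1 : ℝ)) (m x) = 1 := by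
    intro x hx
    obtain ⟨γ, hγ⟩ := hcov x hx
    exact hψ1 _ (hmY x hx) ⟨γ, _, hγ, hmρ γ x hx⟩
  set φ : (σ → ℝ) → ℝ := X.indicator fun x => ψ (m x) with hφdef
  have hφX : ∀ x ∈ X, φ x = ψ (m x) := fun x hx => Set.indicator_of_mem hx _
  set D : Set (σ → ℝ) := X ∩ m ⁻¹' tsupport ψ with hD
  have hDc : IsCompact D := hcpt _ hψY hψc
  have hts : tsupport φ ⊆ D := by
    refine closure_minimal (fun x hx => ?_) hDc.isClosed
    have hxX : x ∈ X := Set.mem_of_indicator_ne_zero hx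
    refine ⟨hxX, subset_tsupport ψ ?_⟩
    rw [Function.mem_support, ← hφX x hxX]
    exact hx
  have htsX : tsupport φ ⊆ X := fun x hx => (hts hx).1
  have hφc : HasCompactSupport φ := hDc.of_isClosed_subset (isClosed_tsupport _) hts
  have hφ : ContDiff ℝ 2 φ := by
    refine contDiff_of_contDiffAt_tsupport fun x hx => ?_
    refine (hψ.contDiffAt.comp x (hm2 x (htsX hx))).congr_of_eventuallyEq ?_
    filter_upwards [hX.mem_nhds (htsX hx)] with z hz using hφX z hz
  have hφ0 : ∀ x, 0 ≤ φ x := fun x => Set.indicator_nonneg (fun _ _ => hψ0 _) x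
  have hfin := hpX (tsupport φ) htsX hφc
  have hSsum : ∀ x ∈ X, ∀ S : Finset Λ, (∀ γ, φ (ρ γ *ᵥ x) ≠ 0 → γ ∈ S) →
      ∑ γ ∈ S, φ (ρ γ *ᵥ x) = 1 := by
    intro x hx S hS
    have h1 : ∀ γ, φ (ρ γ *ᵥ x) = ψ (ρ γ *ᵥ m x) := fun γ => by
      rw [hφX _ (hρX γ x hx), hmρ γ x hx]
    rw [← hψsum x hx, orbitAverage]
    simp_rw [smul_eq_mul, mul_one, ← h1]
    exact (finsum_eq_sum_of_support_subset _ fun γ hγ => hS γ hγ).symm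
  set u : ℝ × (σ → ℝ) → ℂ := fun p => w (rotationHomotopy m p) with hu
  have hwx : ∀ t, ∀ x ∈ X, ContDiffAt ℂ 1 w (rotationHomotopy m (t, x)) := fun t x hx =>
    hw x hx (m x) (hmY x hx) t
  have hinv := integral_detRows_eq_of_equivariant ρ hdet hX hρX (hφ.of_le (by norm_num)) hφc htsX
    (F := rotationHomotopy m) (u := u)
    (fun t x hx => contDiffAt_rotationHomotopy (hm2 x hx) t)
    (fun t x hx => ((hwx t x hx).restrict_scalars ℝ).comp (t, x)
      ((contDiffAt_rotationHomotopy (hm2 x hx) t).of_le (by norm_num)))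
    (fun t x hx => ⟨fderiv ℂ w (rotationHomotopy m (t, x)), fun h => by
      have h1 : HasFDerivAt u (((fderiv ℂ w (rotationHomotopy m (t, x))).restrictScalars ℝ).comp
          (fderiv ℝ (rotationHomotopy m) (t, x))) (t, x) :=
        (((hwx t x hx).differentiableAt (by norm_num)).hasFDerivAt.restrictScalars ℝ).comp (t, x)
          ((contDiffAt_rotationHomotopy (hm2 x hx) t).differentiableAt (by norm_num)).hasFDerivAt
      rw [h1.fderiv]
      rfl⟩)
    (fun γ t x hx => rotationHomotopy_mulVec (hmρ γ x hx) t)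
    (fun γ t x hx => by
      simp only [hu]
      rw [← hwρ γ (rotationHomotopy m (t, x)), ← rotationHomotopy_mulVec (hmρ γ x hx) t])
    hfin.toFinset
    (fun γ hγ => by
      obtain ⟨x, hx, hγx⟩ := hfin.mem_toFinset.1 hγ
      refine hfin.mem_toFinset.2 ⟨_, hγx, ?_⟩
      rwa [Matrix.mulVec_mulVec, ← map_mul, inv_mul_cancel, map_one, Matrix.one_mulVec])
    (fun x hx => hSsum x (htsX hx) _ fun γ hγ =>
      hfin.mem_toFinset.2 ⟨x, hx, subset_tsupport φ hγ⟩) 0 1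
  have hzero : ∫ x, φ x • (u (1, x) * detRows σ (jacRows (rotationHomotopy m) spaceDir (1, x)))
      = 0 := by
    set G : (σ → ℝ) → ℂ := fun y => ψ y • w (Complex.I • complexify σ y) with hGdef
    have hGs : tsupport G ⊆ tsupport ψ := tsupport_smul_subset_left _ _
    obtain ⟨x₁, hx₁⟩ := hXne
    have hG : ContDiff ℝ 1 G := by
      refine contDiff_of_contDiffAt_tsupport fun y hy => ?_
      have h1 := hw x₁ hx₁ y (hψY (hGs hy)) 1
      rw [sub_self, zero_smul, zero_add, one_smul] at h1
      exact (hψ.contDiffAt.of_le (by norm_num)).smul ((h1.restrict_scalars ℝ).comp y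
        ((complexify σ).contDiff.contDiffAt.const_smul Complex.I))
    obtain ⟨φ', hφ'X, hφ'1, hφ'0⟩ := integral_detRows_eq_zero_of_ball_disjoint hX
      (convex_of_add_mem_of_smul_mem hadd hsmul) hm2 hcpt hy₀ hr hmiss hG
      (hψc.of_isClosed_subset (isClosed_tsupport _) hGs) (hGs.trans hψY)
    have h1 : ∀ x, φ x • (u (1, x) * detRows σ (jacRows (rotationHomotopy m) spaceDir (1, x))) =
        Complex.I ^ Fintype.card σ • (φ' x • (G (m x) * detRows σ (realJacRows m x))) := by
      intro x
      by_cases hx : x ∈ X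
      · have h2 : jacRows (rotationHomotopy m) spaceDir (1, x) =
            fun j => Complex.I • realJacRows m x j := by
          funext j
          rw [jacRows, fderiv_rotationHomotopy_spaceDir (hm2 x hx)]
          simp
        have h3 : detRows σ (fun j => Complex.I • realJacRows m x j) =
            Complex.I ^ Fintype.card σ * detRows σ (realJacRows m x) := by
          rw [detRows_apply, detRows_apply, ← Matrix.det_smul]
          rfl
        have h4 : φ' x • G (m x) = G (m x) := by
          by_cases h : G (m x) = 0
          · simp [h]
          · rw [hφ'1 x hx h, one_smul]
        have h5 : φ x • u (1, x) = G (m x) := by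
          simp [hφX x hx, hGdef, hu, rotationHomotopy]
        rw [h2, h3, ← smul_mul_assoc, ← smul_mul_assoc, h4, h5, smul_eq_mul]
        ring
      · rw [image_eq_zero_of_notMem_tsupport fun h => hx (hφ'X h),
          image_eq_zero_of_notMem_tsupport fun h => hx (htsX h)]
        simp
    simp_rw [h1]
    rw [integral_smul, hφ'0, smul_zero]
  rw [hzero] at hinv
  have h0 : ∀ x, φ x • (u (0, x) * detRows σ (jacRows (rotationHomotopy m) spaceDir (0, x))) =
      φ x • w (complexify σ x) := by
    intro x
    by_cases hx : x ∈ X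
    · have h2 : jacRows (rotationHomotopy m) spaceDir (0, x) =
          fun j => complexify σ (Pi.single j 1) := by
        funext j
        rw [jacRows, fderiv_rotationHomotopy_spaceDir (hm2 x hx)]
        simp
      rw [h2, detRows_complexify_single]
      simp [hu, rotationHomotopy]
    · rw [image_eq_zero_of_notMem_tsupport fun h => hx (htsX h), zero_smul, zero_smul]
  simp_rw [h0] at hinv
  have hwc : ∀ x ∈ X, ContinuousAt (fun x => w (complexify σ x)) x := by
    intro x hx
    have h1 := hwx 0 x hx
    have h2 : rotationHomotopy m (0, x) = complexify σ x := by simp [rotationHomotopy]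
    rw [h2] at h1
    exact h1.continuousAt.comp (f := fun x => complexify σ x) (complexify σ).continuous.continuousAt
  have h_int := integrable_smul_of_continuousAt hφ.continuous hφc fun x hx => hwc x (htsX hx)
  set a : (σ → ℝ) → ℝ := fun x => φ x * (c * w (complexify σ x)).re with ha
  have ha0 : ∀ x, 0 ≤ a x := by
    intro x
    by_cases hx : x ∈ X
    · exact mul_nonneg (hφ0 x) (hpos x hx).le
    · simp [ha, image_eq_zero_of_notMem_tsupport fun h => hx (htsX h)]
  have hats : tsupport a ⊆ tsupport φ := tsupport_mul_subset_left
  have hacont : Continuous a := by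
    refine continuous_of_tsupport fun x hx => hφ.continuous.continuousAt.mul ?_
    exact Complex.continuous_re.continuousAt.comp
      (continuousAt_const.mul (hwc x (htsX (hats hx))))
  obtain ⟨x₁, hx₁⟩ := hXne
  obtain ⟨S, hS⟩ := hpX.exists_finset isCompact_singleton (Set.singleton_subset_iff.2 hx₁)
    hφc htsX
  have hsum := hSsum x₁ hx₁ S fun γ hγ => hS γ x₁ rfl (subset_tsupport φ hγ)
  obtain ⟨γ, -, hγ⟩ := Finset.exists_ne_zero_of_sum_ne_zero (hsum.trans_ne one_ne_zero)
  have hapos : 0 < ∫ x, a x := hacont.integral_pos_of_hasCompactSupport_nonneg_nonzero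
    (hφc.of_isClosed_subset (isClosed_tsupport _) hats) ha0 (x := ρ γ *ᵥ x₁)
    (mul_ne_zero hγ (hpos _ (hρX γ _ hx₁)).ne')
  have h1 : ∫ x, a x = (c * ∫ x, φ x • w (complexify σ x)).re := by
    rw [← integral_const_mul, ← RCLike.re_eq_complex_re, ← integral_re (h_int.const_mul c)]
    refine integral_congr_ae (Filter.Eventually.of_forall fun x => ?_)
    simp only [ha, RCLike.re_eq_complex_re, mul_smul_comm, Complex.smul_re, smul_eq_mul]
  rw [h1, hinv] at hapos
  simp at hapos

end Obstruction

section HermitianCoordinates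

variable {ι : Type*}

/-- Linear coordinates on complex matrices for which the real points are the hermitian ones. -/
def hermCoord (ι : Type*) : (ι × ι → ℂ) ≃ₗ[ℂ] Matrix ι ι ℂ where
  toFun z := Matrix.of fun i j => ((z (i, j) + z (j, i)) + Complex.I * (z (i, j) - z (j, i))) / 2
  invFun h := fun p => ((h p.1 p.2 + h p.2 p.1) - Complex.I * (h p.1 p.2 - h p.2 p.1)) / 2
  map_add' z z' := by ext i j; simp; ring
  map_smul' c z := by ext i j; simp; ring
  left_inv z := by
    ext ⟨i, j⟩
    simp only [Matrix.of_apply]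
    linear_combination (z (j, i) - z (i, j)) / 2 * Complex.I_sq
  right_inv h := by
    ext i j
    simp only [Matrix.of_apply]
    linear_combination (h j i - h i j) / 2 * Complex.I_sq

theorem hermCoord_apply (z : ι × ι → ℂ) (i j : ι) :
    hermCoord ι z i j = ((z (i, j) + z (j, i)) + Complex.I * (z (i, j) - z (j, i))) / 2 := rfl

/-- The hermitian matrix with given real coordinates. -/
def ofHermCoord (ι : Type*) : (ι × ι → ℝ) →ₗ[ℝ] Matrix ι ι ℂ :=
  (hermCoord ι).toLinearMap.restrictScalars ℝ ∘ₗ (complexify (ι × ι)).toLinearMap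

theorem hermCoord_complexify (x : ι × ι → ℝ) :
    hermCoord ι (complexify _ x) = ofHermCoord ι x := rfl

theorem ofHermCoord_apply (x : ι × ι → ℝ) (i j : ι) :
    ofHermCoord ι x i j =
      (((x (i, j) : ℂ) + x (j, i)) + Complex.I * (x (i, j) - x (j, i))) / 2 := rfl

/-- The real coordinates of a hermitian matrix. -/
def toHermCoord (ι : Type*) : Matrix ι ι ℂ →ₗ[ℝ] ι × ι → ℝ where
  toFun h p := (h p.1 p.2).re + (h p.1 p.2).im
  map_add' h h' := by ext p; simp; ring
  map_smul' c h := by ext p; simp; ring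

theorem toHermCoord_apply (h : Matrix ι ι ℂ) (p : ι × ι) :
    toHermCoord ι h p = (h p.1 p.2).re + (h p.1 p.2).im := rfl

theorem isHermitian_ofHermCoord (x : ι × ι → ℝ) : (ofHermCoord ι x).IsHermitian := by
  ext i j
  simp only [conjTranspose_apply, ofHermCoord_apply]
  simp
  ring

theorem toHermCoord_ofHermCoord (x : ι × ι → ℝ) : toHermCoord ι (ofHermCoord ι x) = x := by
  ext ⟨i, j⟩
  simp [toHermCoord_apply, ofHermCoord_apply]
  ring

theorem ofHermCoord_toHermCoord {h : Matrix ι ι ℂ} (hh : h.IsHermitian) :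
    ofHermCoord ι (toHermCoord ι h) = h := by
  ext i j
  have h1 : h j i = star (h i j) := by rw [← conjTranspose_apply, hh.eq]
  rw [ofHermCoord_apply, toHermCoord_apply, toHermCoord_apply, h1]
  apply Complex.ext
  · simp
    ring
  · simp

theorem ofHermCoord_injective : Function.Injective (ofHermCoord ι) :=
  Function.LeftInverse.injective toHermCoord_ofHermCoord

theorem continuous_ofHermCoord [Finite ι] : Continuous (ofHermCoord ι) := by
  refine continuous_matrix fun i j => ?_
  simp only [ofHermCoord_apply]
  fun_prop

theorem continuous_toHermCoord [Finite ι] : Continuous (toHermCoord ι) := by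
  refine continuous_pi fun p => ?_
  simp only [toHermCoord_apply]
  fun_prop

variable [Fintype ι] [DecidableEq ι]

/-- The real matrix of the action of `g` on hermitian matrices by congruence. -/
def hermMat (g : Matrix ι ι ℂ) : Matrix (ι × ι) (ι × ι) ℝ :=
  LinearMap.toMatrix' (toHermCoord ι ∘ₗ
    (LinearMap.mulRight ℝ gᴴ ∘ₗ LinearMap.mulLeft ℝ g) ∘ₗ ofHermCoord ι)

theorem hermMat_mulVec (g : Matrix ι ι ℂ) (x : ι × ι → ℝ) :
    hermMat g *ᵥ x = toHermCoord ι (g * ofHermCoord ι x * gᴴ) := by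
  rw [hermMat, LinearMap.toMatrix'_mulVec]
  rfl

theorem ofHermCoord_hermMat_mulVec (g : Matrix ι ι ℂ) (x : ι × ι → ℝ) :
    ofHermCoord ι (hermMat g *ᵥ x) = g * ofHermCoord ι x * gᴴ := by
  rw [hermMat_mulVec, ofHermCoord_toHermCoord]
  exact isHermitian_mul_mul_conjTranspose g (isHermitian_ofHermCoord x)

theorem hermMat_mul (g g' : Matrix ι ι ℂ) : hermMat (g * g') = hermMat g * hermMat g' := by
  refine Matrix.ext_of_mulVec_single fun p => ofHermCoord_injective ?_
  rw [← mulVec_mulVec, ofHermCoord_hermMat_mulVec, ofHermCoord_hermMat_mulVec,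
    ofHermCoord_hermMat_mulVec, conjTranspose_mul]
  simp only [Matrix.mul_assoc]

theorem hermMat_one : hermMat (1 : Matrix ι ι ℂ) = 1 := by
  refine Matrix.ext_of_mulVec_single fun p => ofHermCoord_injective ?_
  rw [ofHermCoord_hermMat_mulVec, one_mulVec]
  simp

theorem hermCoord_hermMat_mulVec (g : Matrix ι ι ℂ) (z : ι × ι → ℂ) :
    hermCoord ι ((hermMat g).map Complex.ofReal *ᵥ z) = g * hermCoord ι z * gᴴ := by
  have hz : z = complexify _ (fun p => (z p).re) +
      Complex.I • complexify _ (fun p => (z p).im) := by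
    ext p
    simp only [Pi.add_apply, Pi.smul_apply, complexify_apply, smul_eq_mul]
    rw [mul_comm, Complex.re_add_im]
  rw [hz, mulVec_add, mulVec_smul, ← complexify_mulVec, ← complexify_mulVec, map_add, map_add,
    map_smul, map_smul]
  simp only [hermCoord_complexify, ofHermCoord_hermMat_mulVec]
  rw [Matrix.mul_add, Matrix.add_mul, Matrix.mul_smul, Matrix.smul_mul]

theorem det_hermMat (g : Matrix ι ι ℂ) :
    ((hermMat g).det : ℂ) = (g.det * star g.det) ^ Fintype.card ι := by
  have h1 : ((hermMat g).det : ℂ) = ((hermMat g).map Complex.ofReal).det :=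
    Complex.ofRealHom.map_det _
  let vecE : Matrix ι ι ℂ ≃ₗ[ℂ] ι × ι → ℂ :=
    { toFun := Matrix.vec
      invFun := fun f => Matrix.of fun i j => f (j, i)
      map_add' := fun _ _ => rfl
      map_smul' := fun _ _ => rfl
      left_inv := fun _ => rfl
      right_inv := fun _ => rfl }
  have h2 : LinearMap.det (Matrix.toLin' ((hermMat g).map Complex.ofReal)) =
      LinearMap.det (Matrix.toLin' ((gᴴ)ᵀ.kronecker g)) := by
    rw [← LinearMap.det_conj (Matrix.toLin' ((hermMat g).map Complex.ofReal))
      ((hermCoord ι).trans vecE)]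
    congr 1
    refine LinearMap.ext fun f => ?_
    obtain ⟨h, rfl⟩ := vecE.surjective f
    simp only [LinearMap.comp_apply, LinearEquiv.coe_coe, Matrix.toLin'_apply]
    rw [ LinearEquiv.trans_symm, LinearEquiv.trans_apply, LinearEquiv.trans_apply,
      LinearEquiv.symm_apply_apply, hermCoord_hermMat_mulVec, LinearEquiv.apply_symm_apply]
    have h4 := kronecker_mulVec_vec g h (gᴴ)ᵀ
    rw [transpose_transpose] at h4
    exact h4.symm
  rw [LinearMap.det_toLin', LinearMap.det_toLin'] at h2
  rw [h1, h2]
  have h3 := Matrix.det_kronecker (gᴴ)ᵀ g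
  rw [det_transpose, det_conjTranspose] at h3
  rw [mul_pow, mul_comm]
  exact h3

end HermitianCoordinates

section HermitianCones

open Topology ComplexOrder

variable {ι : Type*}

/-- Coordinates of the hermitian matrices congruent to `J`. -/
def congrOrbit [Fintype ι] [DecidableEq ι] (J : Matrix ι ι ℂ) : Set (ι × ι → ℝ) :=
  {x | ∃ a : Matrix ι ι ℂ, a.det ≠ 0 ∧ ofHermCoord ι x = a * J * aᴴ}

/-- Coordinates of the positive definite hermitian matrices. -/
def posCone (ι : Type*) [Fintype ι] : Set (ι × ι → ℝ) :=
  {y | ∀ v : ι → ℂ, v ≠ 0 → 0 < (star v ⬝ᵥ (ofHermCoord ι y *ᵥ v)).re}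

variable [Fintype ι]

theorem add_mem_posCone {y z : ι × ι → ℝ} (hy : y ∈ posCone ι) (hz : z ∈ posCone ι) :
    y + z ∈ posCone ι := fun v hv => by
  rw [map_add, add_mulVec, dotProduct_add, Complex.add_re]
  exact add_pos (hy v hv) (hz v hv)

theorem smul_mem_posCone {r : ℝ} (hr : 0 < r) {y : ι × ι → ℝ} (hy : y ∈ posCone ι) :
    r • y ∈ posCone ι := fun v hv => by
  rw [map_smul, smul_mulVec, dotProduct_smul, Complex.smul_re]
  exact mul_pos hr (hy v hv)

theorem continuous_hermForm :
    Continuous fun p : (ι × ι → ℝ) × (ι → ℂ) =>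
      (star p.2 ⬝ᵥ (ofHermCoord ι p.1 *ᵥ p.2)).re := by
  have := (continuous_ofHermCoord (ι := ι)).comp
    (continuous_fst (X := ι × ι → ℝ) (Y := ι → ℂ))
  exact Complex.continuous_re.comp
    (continuous_snd.star.dotProduct (this.matrix_mulVec continuous_snd))

theorem hermForm_smul (h : Matrix ι ι ℂ) (r : ℝ) (v : ι → ℂ) :
    (star ((r : ℂ) • v) ⬝ᵥ (h *ᵥ ((r : ℂ) • v))).re = r ^ 2 * (star v ⬝ᵥ (h *ᵥ v)).re := by
  rw [mulVec_smul, star_smul, smul_dotProduct, dotProduct_smul, Complex.star_def,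
    Complex.conj_ofReal, smul_eq_mul, smul_eq_mul, Complex.re_ofReal_mul,
    Complex.re_ofReal_mul, sq, mul_assoc]

theorem isOpen_posCone : IsOpen (posCone ι) := by
  rw [isOpen_iff_mem_nhds]
  intro y hy
  have h1 := (isCompact_sphere (0 : ι → ℂ) 1).eventually_forall_of_forall_eventually
    (x₀ := y) (P := fun z v => 0 < (star v ⬝ᵥ (ofHermCoord ι z *ᵥ v)).re) fun v hv =>
      (continuous_hermForm.tendsto (y, v)).eventually_const_lt (hy v fun h => by simp [h] at hv)
  filter_upwards [h1] with z hz v hv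
  have hn : 0 < ‖v‖ := norm_pos_iff.2 hv
  have h2 := hz (((‖v‖⁻¹ : ℝ) : ℂ) • v) (by
    rw [mem_sphere_zero_iff_norm, norm_smul, Complex.norm_real, norm_inv, norm_norm,
      inv_mul_cancel₀ hn.ne'])
  rw [hermForm_smul] at h2
  have h3 : 0 < ‖v‖⁻¹ ^ 2 := by positivity
  exact pos_of_mul_pos_right h2 h3.le

theorem im_hermForm {h : Matrix ι ι ℂ} (hh : h.IsHermitian) (v : ι → ℂ) :
    (star v ⬝ᵥ (h *ᵥ v)).im = 0 := by
  rw [← Complex.conj_eq_iff_im, ← Complex.star_def, ← star_dotProduct, star_mulVec,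
    hh.eq, ← dotProduct_mulVec]

theorem hermForm_congr (g h : Matrix ι ι ℂ) (v : ι → ℂ) :
    star v ⬝ᵥ ((g * h * gᴴ) *ᵥ v) = star (gᴴ *ᵥ v) ⬝ᵥ (h *ᵥ (gᴴ *ᵥ v)) := by
  rw [star_mulVec, conjTranspose_conjTranspose, ← dotProduct_mulVec, mulVec_mulVec, mulVec_mulVec,
    Matrix.mul_assoc]

theorem smul_congr {r : ℝ} (hr : 0 ≤ r) (a J : Matrix ι ι ℂ) :
    ((√r : ℝ) : ℂ) • a * J * (((√r : ℝ) : ℂ) • a)ᴴ = r • (a * J * aᴴ) := by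
  rw [conjTranspose_smul, Complex.star_def, Complex.conj_ofReal, Matrix.smul_mul, Matrix.smul_mul,
    Matrix.mul_smul, smul_smul, ← Complex.ofReal_mul, Real.mul_self_sqrt hr]
  rfl

variable [DecidableEq ι]

theorem smul_hermMat_mulVec_mem_posCone {r : ℝ} (hr : 0 < r) {g : Matrix ι ι ℂ} (hg : g.det ≠ 0)
    {y : ι × ι → ℝ} (hy : y ∈ posCone ι) : (r • hermMat g) *ᵥ y ∈ posCone ι := by
  rw [smul_mulVec]
  refine smul_mem_posCone hr fun v hv => ?_
  rw [ofHermCoord_hermMat_mulVec, hermForm_congr]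
  refine hy _ fun h => hv (eq_zero_of_mulVec_eq_zero ?_ h)
  rw [det_conjTranspose]
  exact star_ne_zero.2 hg

theorem toHermCoord_mul_conjTranspose_mem_posCone {g : Matrix ι ι ℂ} (hg : g.det ≠ 0) :
    toHermCoord ι (g * gᴴ) ∈ posCone ι := by
  have h1 : toHermCoord ι (1 : Matrix ι ι ℂ) ∈ posCone ι := fun v hv => by
    rw [ofHermCoord_toHermCoord isHermitian_one, one_mulVec]
    exact (Complex.lt_def.1 (dotProduct_star_self_pos_iff.2 hv)).1
  have h2 := smul_hermMat_mulVec_mem_posCone one_pos hg h1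
  rwa [one_smul, hermMat_mulVec, ofHermCoord_toHermCoord isHermitian_one, Matrix.mul_one] at h2

theorem det_ne_zero_of_mem_posCone {y : ι × ι → ℝ} (hy : y ∈ posCone ι) :
    (ofHermCoord ι y).det ≠ 0 := fun h => by
  obtain ⟨v, hv, h0⟩ := exists_mulVec_eq_zero_iff.2 h
  have := hy v hv
  simp [h0] at this

theorem smul_congr_mem_congrOrbit {J : Matrix ι ι ℂ} {r : ℝ} (hr : 0 < r) {a : Matrix ι ι ℂ}
    (ha : a.det ≠ 0) (hJ : J.IsHermitian) : toHermCoord ι (r • (a * J * aᴴ)) ∈ congrOrbit J := by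
  refine ⟨((√r : ℝ) : ℂ) • a, ?_, ?_⟩
  · rw [det_smul]
    exact mul_ne_zero (pow_ne_zero _ (Complex.ofReal_ne_zero.2 (Real.sqrt_pos.2 hr).ne')) ha
  · rw [smul_congr hr.le, map_smul, map_smul,
      ofHermCoord_toHermCoord (isHermitian_mul_mul_conjTranspose a hJ)]

theorem smul_hermMat_mulVec_mem_congrOrbit {J : Matrix ι ι ℂ} (hJ : J.IsHermitian) {r : ℝ}
    (hr : 0 < r) {g : Matrix ι ι ℂ} (hg : g.det ≠ 0) {x : ι × ι → ℝ} (hx : x ∈ congrOrbit J) :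
    (r • hermMat g) *ᵥ x ∈ congrOrbit J := by
  obtain ⟨a, ha, hxa⟩ := hx
  have h1 : (g * a).det ≠ 0 := by
    rw [det_mul]
    exact mul_ne_zero hg ha
  have h2 := smul_congr_mem_congrOrbit hr h1 hJ
  convert h2
  rw [smul_mulVec, hermMat_mulVec, map_smul, hxa, conjTranspose_mul]
  simp only [Matrix.mul_assoc]

theorem det_ofHermCoord_of_congr {J a : Matrix ι ι ℂ} {x : ι × ι → ℝ}
    (h : ofHermCoord ι x = a * J * aᴴ) :
    (ofHermCoord ι x).det = ((‖a.det‖ ^ 2 : ℝ) : ℂ) * J.det := by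
  rw [h, det_mul, det_mul, det_conjTranspose, Complex.ofReal_pow, ← Complex.conj_mul',
    Complex.star_def]
  ring

theorem det_hermCoord_segment_ne_zero {J : Matrix ι ι ℂ} (hJ : J.det ≠ 0) {x y : ι × ι → ℝ}
    (hx : x ∈ congrOrbit J) (hy : y ∈ posCone ι) (t : ℝ) :
    (hermCoord ι ((1 - t) • complexify _ x + t • (Complex.I • complexify _ y))).det ≠ 0 := by
  intro h0
  obtain ⟨v, hv, h1⟩ := exists_mulVec_eq_zero_iff.2 h0
  have h2 : hermCoord ι ((1 - t) • complexify _ x + t • (Complex.I • complexify _ y)) =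
      (1 - t) • ofHermCoord ι x + t • (Complex.I • ofHermCoord ι y) := by
    ext i j
    simp only [hermCoord_apply, ofHermCoord_apply, Matrix.add_apply, Matrix.smul_apply,
      Pi.add_apply, Pi.smul_apply, complexify_apply, Complex.real_smul, smul_eq_mul]
    ring
  have h3 := congrArg (fun u => (star v ⬝ᵥ u).im) h1
  simp only [h2, add_mulVec, smul_mulVec, dotProduct_add, dotProduct_smul, Complex.add_im,
    Complex.smul_im, im_hermForm (isHermitian_ofHermCoord x), smul_eq_mul, Complex.I_mul_im,
    dotProduct_zero, Complex.zero_im, mul_zero, zero_add] at h3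
  obtain rfl : t = 0 := (mul_eq_zero.1 h3).resolve_right (hy v hv).ne'
  obtain ⟨a, ha, hxa⟩ := hx
  rw [h2, zero_smul, sub_zero, one_smul, add_zero, det_ofHermCoord_of_congr hxa] at h0
  exact mul_ne_zero (Complex.ofReal_ne_zero.2 (pow_ne_zero 2 (norm_ne_zero_iff.2 ha))) hJ h0

/-- The density of the invariant holomorphic volume form. -/
def invDensity (ι : Type*) [Fintype ι] [DecidableEq ι] (z : ι × ι → ℂ) : ℂ :=
  ((hermCoord ι z).det ^ Fintype.card ι)⁻¹

theorem contDiffAt_invDensity {z : ι × ι → ℂ} (hz : (hermCoord ι z).det ≠ 0) :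
    ContDiffAt ℂ 1 (invDensity ι) z := by
  have h1 : ContDiff ℂ 1 fun z : ι × ι → ℂ => (hermCoord ι z).det := by
    simp only [det_apply, hermCoord_apply, Units.smul_def, zsmul_eq_mul]
    fun_prop
  exact (h1.pow _).contDiffAt.inv (pow_ne_zero _ hz)

theorem invDensity_smul_hermMat {r : ℝ} (hr : r ≠ 0) {g : Matrix ι ι ℂ} (hg : g.det = 1)
    (z : ι × ι → ℂ) :
    (r • hermMat g).det • invDensity ι ((r • hermMat g).map Complex.ofReal *ᵥ z) =
      invDensity ι z := by
  have h1 : (r • hermMat g).map Complex.ofReal = (r : ℂ) • (hermMat g).map Complex.ofReal := by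
    ext
    simp
  have h2 : ((hermMat g).det : ℂ) = 1 := by simp [det_hermMat, hg]
  have h3 : (hermMat g).det = 1 := by exact_mod_cast h2
  rw [invDensity, h1, smul_mulVec, map_smul, hermCoord_hermMat_mulVec, det_smul, det_smul,
    det_mul, det_mul, det_conjTranspose, hg, h3, star_one, mul_one, one_mul, mul_one, mul_pow,
    ← pow_mul, Fintype.card_prod, Complex.real_smul, mul_inv, ← mul_assoc, Complex.ofReal_pow,
    mul_inv_cancel₀ (pow_ne_zero _ (Complex.ofReal_ne_zero.2 hr)), one_mul, invDensity]

theorem re_invDensity_pos {J : Matrix ι ι ℂ} (hJ : J.det ≠ 0) {x : ι × ι → ℝ}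
    (hx : x ∈ congrOrbit J) :
    0 < (J.det ^ Fintype.card ι * invDensity ι (complexify _ x)).re := by
  obtain ⟨a, ha, hxa⟩ := hx
  rw [invDensity, hermCoord_complexify, det_ofHermCoord_of_congr hxa, mul_pow, mul_inv,
    mul_left_comm, mul_inv_cancel₀ (pow_ne_zero _ hJ), mul_one, ← Complex.ofReal_pow,
    ← Complex.ofReal_inv, Complex.ofReal_re]
  have := norm_pos_iff.2 ha
  positivity

end HermitianCones

section Submersion

open Topology Matrix.Norms.Elementwise

theorem exists_isCompact_lift {E F : Type*} [TopologicalSpace E] [TopologicalSpace F]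
    [LocallyCompactSpace E] {f : E → F} {U : Set E} (hU : IsOpen U)
    (hf : ∀ a ∈ U, 𝓝 (f a) ≤ Filter.map f (𝓝 a)) {K : Set F} (hK : IsCompact K)
    (hKU : K ⊆ f '' U) : ∃ K₁ ⊆ U, IsCompact K₁ ∧ K ⊆ f '' K₁ := by
  have h1 : ∀ x ∈ K, ∃ N ⊆ U, IsCompact N ∧ f '' N ∈ 𝓝 x := fun x hx => by
    obtain ⟨a, ha, rfl⟩ := hKU hx
    obtain ⟨N, hN, haN, hNU⟩ := exists_compact_subset hU ha
    exact ⟨N, hNU, hN, hf a ha (Filter.image_mem_map (mem_interior_iff_mem_nhds.1 haN))⟩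
  choose! N hNU hN hfN using h1
  obtain ⟨t, htK, ht⟩ := hK.elim_nhds_subcover (fun x => f '' N x) hfN
  refine ⟨⋃ x ∈ t, N x, Set.iUnion₂_subset fun x hx => hNU x (htK x hx),
    t.isCompact_biUnion fun x hx => hN x (htK x hx), ht.trans ?_⟩
  rw [Set.image_iUnion₂]

variable {ι : Type*} [Fintype ι]

/-- The coordinates of `a * J * aᴴ`. -/
def congrMap (J a : Matrix ι ι ℂ) : ι × ι → ℝ := toHermCoord ι (a * J * aᴴ)

theorem continuous_congrMap (J : Matrix ι ι ℂ) : Continuous (congrMap J) := by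
  refine continuous_toHermCoord.comp ?_
  fun_prop

theorem ofHermCoord_congrMap {J : Matrix ι ι ℂ} (hJ : J.IsHermitian) (a : Matrix ι ι ℂ) :
    ofHermCoord ι (congrMap J a) = a * J * aᴴ :=
  ofHermCoord_toHermCoord (isHermitian_mul_mul_conjTranspose a hJ)

variable [DecidableEq ι]

theorem congrOrbit_eq_image {J : Matrix ι ι ℂ} (hJ : J.IsHermitian) :
    congrOrbit J = congrMap J '' {a | a.det ≠ 0} := by
  ext x
  constructor
  · rintro ⟨a, ha, hx⟩
    exact ⟨a, ha, by rw [congrMap, ← hx, toHermCoord_ofHermCoord]⟩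
  · rintro ⟨a, ha, rfl⟩
    exact ⟨a, ha, ofHermCoord_congrMap hJ a⟩

theorem map_nhds_congrMap {J a : Matrix ι ι ℂ} (hJ : J.IsHermitian) (hJ' : J.det ≠ 0)
    (ha : a.det ≠ 0) : Filter.map (congrMap J) (𝓝 a) = 𝓝 (congrMap J a) := by
  let B : Matrix ι ι ℂ →ₗ[ℝ] Matrix ι ι ℂ →ₗ[ℝ] ι × ι → ℝ :=
    LinearMap.mk₂ ℝ (fun a b => toHermCoord ι (a * J * bᴴ))
      (fun a b c => by rw [Matrix.add_mul, Matrix.add_mul, map_add])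
      (fun r a b => by rw [Matrix.smul_mul, Matrix.smul_mul, map_smul])
      (fun a b c => by rw [conjTranspose_add, Matrix.mul_add, map_add])
      (fun r a b => by rw [conjTranspose_smul, star_trivial, Matrix.mul_smul, map_smul])
  let B' := B.toContinuousBilinearMap
  have hB : ∀ a b, B' a b = toHermCoord ι (a * J * bᴴ) := fun a b => rfl
  have h1 := (B'.hasStrictFDerivAt_of_bilinear (hasStrictFDerivAt_id (𝕜 := ℝ) a)
    (hasStrictFDerivAt_id (𝕜 := ℝ) a))
  refine h1.map_nhds_eq_of_surj (LinearMap.range_eq_top.2 fun y => ?_)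
  have hc : IsUnit (J * aᴴ).det := by
    rw [det_mul, det_conjTranspose]
    exact (mul_ne_zero hJ' (star_ne_zero.2 ha)).isUnit
  set h := (1 / 2 : ℝ) • ofHermCoord ι y with hh
  have hherm : hᴴ = h := by
    rw [hh, conjTranspose_smul, star_trivial, (isHermitian_ofHermCoord y).eq]
  have h2 : h * (J * aᴴ)⁻¹ * J * aᴴ = h := by
    rw [Matrix.mul_assoc, Matrix.mul_assoc, nonsing_inv_mul _ hc, Matrix.mul_one]
  have h3 : a * J * (h * (J * aᴴ)⁻¹)ᴴ = h := by
    conv_rhs => rw [← hherm, ← h2]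
    rw [conjTranspose_mul (h * (J * aᴴ)⁻¹ * J), conjTranspose_mul _ J, hJ.eq,
      conjTranspose_conjTranspose, Matrix.mul_assoc]
  refine ⟨h * (J * aᴴ)⁻¹, ?_⟩
  change toHermCoord ι (a * J * (h * (J * aᴴ)⁻¹)ᴴ) +
    toHermCoord ι (h * (J * aᴴ)⁻¹ * J * aᴴ) = y
  rw [h2, h3, hh, map_smul, toHermCoord_ofHermCoord, ← add_smul]
  norm_num

theorem isOpen_det_ne_zero : IsOpen {a : Matrix ι ι ℂ | a.det ≠ 0} :=
  isOpen_ne_fun (by fun_prop) continuous_const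

theorem isOpen_congrOrbit {J : Matrix ι ι ℂ} (hJ : J.IsHermitian) (hJ' : J.det ≠ 0) :
    IsOpen (congrOrbit J) := by
  rw [congrOrbit_eq_image hJ, isOpen_iff_mem_nhds]
  rintro _ ⟨a, ha, rfl⟩
  rw [← map_nhds_congrMap hJ hJ' ha]
  exact Filter.image_mem_map (isOpen_det_ne_zero.mem_nhds ha)

theorem exists_isCompact_lift_congrMap {J : Matrix ι ι ℂ} (hJ : J.IsHermitian) (hJ' : J.det ≠ 0)
    {K : Set (ι × ι → ℝ)} (hK : IsCompact K) (hKX : K ⊆ congrOrbit J) :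
    ∃ K₁ ⊆ {a : Matrix ι ι ℂ | a.det ≠ 0}, IsCompact K₁ ∧ K ⊆ congrMap J '' K₁ :=
  haveI : LocallyCompactSpace (Matrix ι ι ℂ) := inferInstanceAs (LocallyCompactSpace (ι → ι → ℂ))
  exists_isCompact_lift isOpen_det_ne_zero (fun _ ha => (map_nhds_congrMap hJ hJ' ha).ge) hK
    (congrOrbit_eq_image hJ ▸ hKX)

end Submersion

section Group

open Topology

variable {p q : ℕ}

theorem isHermitian_JCpq : (JCpq p q).IsHermitian := by
  refine isHermitian_diagonal_of_self_adjoint _ ?_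
  rw [isSelfAdjoint_iff]
  ext i
  rcases i with i | i <;> simp

theorem JCpq_mul_self : JCpq p q * JCpq p q = 1 := by
  rw [JCpq, diagonal_mul_diagonal, ← diagonal_one]
  congr 1
  ext i
  rcases i with i | i <;> simp

theorem det_JCpq_ne_zero : (JCpq p q).det ≠ 0 := fun h => by
  have := congrArg Matrix.det (JCpq_mul_self (p := p) (q := q))
  simp [h] at this

/-- The elements of `SL(p+q, ℂ)` with entries bounded by `R`. -/
def slBall (p q : ℕ) (R : ℝ) : Set (SLCpq p q) := {g | ∀ i j, ‖g.val.val i j‖ ≤ R}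

theorem continuous_SLCpq_val : Continuous fun g : SLCpq p q => g.val.val :=
  Units.continuous_val.comp continuous_subtype_val

/-- The element of `SL(p+q, ℂ)` given by a matrix of determinant one. -/
def slOf (a : Matrix (Fin p ⊕ Fin q) (Fin p ⊕ Fin q) ℂ) (ha : a.det = 1) : SLCpq p q :=
  ⟨⟨a, a.adjugate, by rw [mul_adjugate, ha, one_smul], by rw [adjugate_mul, ha, one_smul]⟩, ha⟩

theorem isCompact_slBall (R : ℝ) : IsCompact (slBall p q R) := by
  let S := {a : Matrix (Fin p ⊕ Fin q) (Fin p ⊕ Fin q) ℂ | a.det = 1}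
  have hS : IsClosed S := isClosed_eq (by fun_prop) continuous_const
  have h1 : Continuous fun a : S => slOf a.1 a.2 := by
    refine Continuous.subtype_mk (Units.continuous_iff.2 ⟨continuous_subtype_val, ?_⟩) _
    exact continuous_subtype_val.matrix_adjugate
  have h2 : IsCompact {a : Matrix (Fin p ⊕ Fin q) (Fin p ⊕ Fin q) ℂ | ∀ i j, ‖a i j‖ ≤ R} := by
    have h3 : {a : Matrix (Fin p ⊕ Fin q) (Fin p ⊕ Fin q) ℂ | ∀ i j, ‖a i j‖ ≤ R} =
        (Set.univ.pi fun _ => Set.univ.pi fun _ => Metric.closedBall (0 : ℂ) R :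
          Set ((Fin p ⊕ Fin q) → (Fin p ⊕ Fin q) → ℂ)) := by
      refine Set.ext fun a => ?_
      change (∀ i j, ‖a i j‖ ≤ R) ↔
        ∀ i, i ∈ Set.univ → ∀ j, j ∈ Set.univ → a i j ∈ Metric.closedBall 0 R
      simp [-Sum.forall]
    rw [h3]
    exact isCompact_univ_pi fun _ => isCompact_univ_pi fun _ => isCompact_closedBall 0 R
  have h3 := (hS.isClosedEmbedding_subtypeVal.isCompact_preimage h2).image h1
  convert h3
  ext g
  constructor
  · exact fun hg => ⟨⟨g.val.val, g.2⟩, hg, Subtype.ext (Units.ext rfl)⟩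
  · rintro ⟨a, ha, rfl⟩
    exact ha

theorem JCpq_conj_of_mem {c : SLCpq p q} (hc : c ∈ SUpq p q) :
    c.val.val * JCpq p q * c.val.valᴴ = JCpq p q := by
  have h1 : JCpq p q * c.val.valᴴ * JCpq p q * c.val.val = 1 := by
    rw [Matrix.mul_assoc, Matrix.mul_assoc, ← Matrix.mul_assoc c.val.valᴴ]
    exact (congrArg _ hc).trans JCpq_mul_self
  have h2 := mul_eq_one_comm.1 h1
  calc c.val.val * JCpq p q * c.val.valᴴ
      = c.val.val * (JCpq p q * c.val.valᴴ * JCpq p q) * JCpq p q := by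
        simp only [Matrix.mul_assoc, JCpq_mul_self, Matrix.mul_one]
    _ = JCpq p q := by rw [h2, Matrix.one_mul]

theorem mem_SUpq_of_conj {c : SLCpq p q}
    (hc : c.val.val * JCpq p q * c.val.valᴴ = JCpq p q) : c ∈ SUpq p q := by
  have h1 : c.val.val * (JCpq p q * c.val.valᴴ * JCpq p q) = 1 := by
    rw [← Matrix.mul_assoc, ← Matrix.mul_assoc, hc, JCpq_mul_self]
  have h2 := mul_eq_one_comm.1 h1
  change c.val.valᴴ * JCpq p q * c.val.val = JCpq p q
  calc c.val.valᴴ * JCpq p q * c.val.val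
      = JCpq p q * (JCpq p q * c.val.valᴴ * JCpq p q * c.val.val) := by
        simp only [← Matrix.mul_assoc, JCpq_mul_self, Matrix.one_mul]
    _ = JCpq p q := by rw [h2, Matrix.mul_one]

theorem SLCpq_mul_val (a b : SLCpq p q) : (a * b).val.val = a.val.val * b.val.val := rfl

theorem SLCpq_one_val : (1 : SLCpq p q).val.val = 1 := rfl

theorem SLCpq_det (a : SLCpq p q) : a.val.val.det = 1 := a.2

theorem isOpen_entries_lt (k : ℝ) : IsOpen {g : SLCpq p q | ∀ i j, ‖g.val.val i j‖ < k} := by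
  simp only [Set.ofPred_forall]
  refine isOpen_iInter_of_finite fun i => isOpen_iInter_of_finite fun j => ?_
  exact isOpen_lt (continuous_SLCpq_val.matrix_elem i j).norm continuous_const

theorem exists_entries_lt {ι : Type*} [Fintype ι] (a : Matrix ι ι ℂ) :
    ∃ k : ℕ, ∀ i j, ‖a i j‖ < k := by
  obtain ⟨k, hk⟩ := exists_nat_gt (∑ i, ∑ j, ‖a i j‖)
  refine ⟨k, fun i j => lt_of_le_of_lt ?_ hk⟩
  exact (Finset.single_le_sum (f := fun j => ‖a i j‖) (fun _ _ => norm_nonneg _)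
    (Finset.mem_univ j)).trans (Finset.single_le_sum (f := fun i => ∑ j, ‖a i j‖)
      (fun _ _ => Finset.sum_nonneg fun _ _ => norm_nonneg _) (Finset.mem_univ i))

theorem congrMap_eq_of_inv_mul_mem {a b : SLCpq p q} (h : a⁻¹ * b ∈ SUpq p q) :
    congrMap (JCpq p q) a.val.val = congrMap (JCpq p q) b.val.val := by
  obtain ⟨c, rfl⟩ : ∃ c, b = a * c := ⟨a⁻¹ * b, by group⟩
  rw [inv_mul_cancel_left] at h
  rw [congrMap, congrMap, SLCpq_mul_val, conjTranspose_mul]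
  congr 1
  calc a.val.val * JCpq p q * a.val.valᴴ
      = a.val.val * (c.val.val * JCpq p q * c.val.valᴴ) * a.val.valᴴ := by
        rw [JCpq_conj_of_mem h]
    _ = _ := by simp only [Matrix.mul_assoc]

variable (Γ : Subgroup (SLCpq p q))

theorem finite_return [ProperlyDiscontinuousSMul Γ (SLCpq p q ⧸ SUpq p q)] (R : ℝ) :
    {γ : Γ | ∃ a ∈ slBall p q R, ∃ b ∈ slBall p q R,
      congrMap (JCpq p q) (γ.1 * a).val.val = congrMap (JCpq p q) b.val.val}.Finite := by
  have hc : IsCompact ((fun g : SLCpq p q => (g : SLCpq p q ⧸ SUpq p q)) '' slBall p q R) :=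
    (isCompact_slBall R).image continuous_quotient_mk'
  refine (ProperlyDiscontinuousSMul.finite_disjoint_inter_image (Γ := Γ) hc hc).subset ?_
  rintro γ ⟨a, ha, b, hb, hab⟩
  have h1 := congrArg (ofHermCoord _) hab
  rw [ofHermCoord_congrMap isHermitian_JCpq, ofHermCoord_congrMap isHermitian_JCpq] at h1
  have h2 : b⁻¹ * (γ.1 * a) ∈ SUpq p q := by
    refine mem_SUpq_of_conj ?_
    have h3 : (b⁻¹).val.val * b.val.val = 1 := by rw [← SLCpq_mul_val, inv_mul_cancel]; rfl
    rw [SLCpq_mul_val b⁻¹, conjTranspose_mul]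
    calc _ = (b⁻¹).val.val * ((γ.1 * a).val.val * JCpq p q * (γ.1 * a).val.valᴴ) *
          (b⁻¹).val.valᴴ := by simp only [Matrix.mul_assoc]
      _ = ((b⁻¹).val.val * b.val.val) * JCpq p q * ((b⁻¹).val.val * b.val.val)ᴴ := by
        rw [h1, conjTranspose_mul]
        simp only [Matrix.mul_assoc]
      _ = _ := by rw [h3, Matrix.one_mul, conjTranspose_one, Matrix.mul_one]
  refine ⟨(b : SLCpq p q ⧸ SUpq p q), ⟨(a : SLCpq p q ⧸ SUpq p q), ⟨a, ha, rfl⟩, ?_⟩, b, hb, rfl⟩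
  exact (QuotientGroup.eq.2 h2).symm

theorem exists_slBall_cover
    [CompactSpace (MulAction.orbitRel.Quotient Γ (SLCpq p q ⧸ SUpq p q))] :
    ∃ R : ℝ, ∀ g : SLCpq p q, ∃ γ : Γ, ∃ a ∈ slBall p q R,
      congrMap (JCpq p q) (γ.1 * g).val.val = congrMap (JCpq p q) a.val.val := by
  have : ContinuousConstSMul Γ (SLCpq p q ⧸ SUpq p q) := ⟨fun γ => continuous_const_smul γ.1⟩
  have hπ : IsOpenMap fun g : SLCpq p q => (Quotient.mk (MulAction.orbitRel Γ _)
      (g : SLCpq p q ⧸ SUpq p q) : MulAction.orbitRel.Quotient Γ (SLCpq p q ⧸ SUpq p q)) :=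
    (isOpenMap_quotient_mk'_mul (Γ := Γ)).comp QuotientGroup.isOpenMap_coe
  have hdir : Directed (· ⊆ ·) fun k : ℕ => (fun g : SLCpq p q =>
      (Quotient.mk (MulAction.orbitRel Γ _) (g : SLCpq p q ⧸ SUpq p q) :
        MulAction.orbitRel.Quotient Γ (SLCpq p q ⧸ SUpq p q))) ''
      {g | ∀ i j, ‖g.val.val i j‖ < k} :=
    directed_of_isDirected_le fun k l hkl => Set.image_mono fun g hg i j =>
      (hg i j).trans_le (Nat.cast_le.2 hkl)
  obtain ⟨k, hk⟩ := isCompact_univ.elim_directed_cover _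
    (fun k : ℕ => hπ _ (isOpen_entries_lt k)) (fun x _ => by
      obtain ⟨y, rfl⟩ := Quotient.mk_surjective x
      obtain ⟨g, rfl⟩ := QuotientGroup.mk_surjective y
      obtain ⟨k, hk⟩ := exists_entries_lt g.val.val
      exact Set.mem_iUnion.2 ⟨k, g, hk, rfl⟩) hdir
  refine ⟨k, fun g => ?_⟩
  obtain ⟨a, ha, hag⟩ := hk (Set.mem_univ (Quotient.mk _ (g : SLCpq p q ⧸ SUpq p q)))
  obtain ⟨γ, hγ⟩ := MulAction.orbitRel_apply.1 (Quotient.exact hag)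
  refine ⟨γ, a, fun i j => (ha i j).le, ?_⟩
  exact congrMap_eq_of_inv_mul_mem (QuotientGroup.eq.1 hγ)

/-- The group `Γ × ℤ` acting on hermitian matrices by congruence and scaling by powers of two. -/
def hermRep : Γ × Multiplicative ℤ →*
    Matrix ((Fin p ⊕ Fin q) × (Fin p ⊕ Fin q)) ((Fin p ⊕ Fin q) × (Fin p ⊕ Fin q)) ℝ where
  toFun γ := (2 : ℝ) ^ γ.2.toAdd • hermMat γ.1.1.val.val
  map_one' := by simp [hermMat_one]
  map_mul' γ γ' := by
    simp only [Prod.snd_mul, Prod.fst_mul, toAdd_mul, Subgroup.coe_mul, Units.val_mul, hermMat_mul,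
      zpow_add₀ (two_ne_zero' ℝ), Matrix.smul_mul, Matrix.mul_smul, smul_smul,
      mul_comm ((2 : ℝ) ^ γ.2.toAdd)]

theorem hermRep_apply (γ : Γ × Multiplicative ℤ) :
    hermRep Γ γ = (2 : ℝ) ^ γ.2.toAdd • hermMat γ.1.1.val.val := rfl

end Group

section Bounds

theorem IsCompact.exists_bounds_of_pos {E : Type*} [TopologicalSpace E] {K : Set E}
    (hK : IsCompact K) {f : E → ℝ} (hf : Continuous f) (hpos : ∀ x ∈ K, 0 < f x) :
    ∃ C : ℝ, 1 ≤ C ∧ ∀ x ∈ K, f x ≤ C ∧ C⁻¹ ≤ f x := by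
  obtain ⟨a, ha⟩ := (hK.image hf).bddAbove
  obtain ⟨b, hb⟩ := (hK.image_of_continuousOn
    (hf.continuousOn.inv₀ fun x hx => (hpos x hx).ne')).bddAbove
  refine ⟨max 1 (max a b), le_max_left _ _, fun x hx => ⟨?_, ?_⟩⟩
  · exact (ha ⟨x, hx, rfl⟩).trans ((le_max_left a b).trans (le_max_right _ _))
  · rw [inv_le_comm₀ (lt_of_lt_of_le one_pos (le_max_left _ _)) (hpos x hx)]
    exact (hb ⟨x, hx, rfl⟩).trans ((le_max_right a b).trans (le_max_right _ _))

theorem le_of_pow_le_of_one_le {C s : ℝ} {n : ℕ} (hn : n ≠ 0) (hC : 1 ≤ C) (h : s ^ n ≤ C) :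
    s ≤ C := by
  by_contra! hs
  exact absurd ((le_self_pow₀ (hC.trans hs.le) hn).trans h) hs.not_ge

theorem inv_le_of_inv_le_pow {C s : ℝ} {n : ℕ} (hn : n ≠ 0) (hC : 1 ≤ C) (hs : 0 < s)
    (h : C⁻¹ ≤ s ^ n) : C⁻¹ ≤ s := by
  have hC' : 0 < C := one_pos.trans_le hC
  rw [inv_le_comm₀ hC' hs]
  rw [inv_le_comm₀ hC' (pow_pos hs n), ← inv_pow] at h
  exact le_of_pow_le_of_one_le hn hC h

theorem finite_zpow_mem_Icc (C : ℝ) :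
    {k : Multiplicative ℤ | C⁻¹ ≤ (2 : ℝ) ^ k.toAdd ∧ (2 : ℝ) ^ k.toAdd ≤ C}.Finite := by
  obtain ⟨N, hN⟩ := pow_unbounded_of_one_lt C (one_lt_two (α := ℝ))
  refine ((Set.finite_Icc (-N : ℤ) N).preimage
    (Multiplicative.toAdd.injective.injOn)).subset fun k hk => ?_
  have hC : 0 < C := (zpow_pos two_pos _).trans_le hk.2
  have h1 : (2 : ℝ) ^ k.toAdd < 2 ^ (N : ℤ) := hk.2.trans_lt (by rwa [zpow_natCast])
  have h2 : (2 : ℝ) ^ (-N : ℤ) < 2 ^ k.toAdd := lt_of_lt_of_le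
    (by rw [_root_.zpow_neg, zpow_natCast]; exact inv_strictAnti₀ hC hN) hk.1
  rw [zpow_lt_zpow_iff_right₀ one_lt_two] at h1 h2
  exact ⟨h2.le, h1.le⟩

end Bounds

section Congruence

variable {ι : Type*} [Fintype ι]

theorem congrMap_smul (J a : Matrix ι ι ℂ) (c : ℂ) :
    congrMap J (c • a) = ‖c‖ ^ 2 • congrMap J a := by
  rw [congrMap, conjTranspose_smul, Matrix.smul_mul, Matrix.smul_mul, Matrix.mul_smul, smul_smul,
    Complex.star_def, Complex.mul_conj', congrMap, ← map_smul]
  congr 1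
  ext i j
  simp

variable [DecidableEq ι]

theorem hermMat_mulVec_congrMap {J : Matrix ι ι ℂ} (hJ : J.IsHermitian) (g a : Matrix ι ι ℂ) :
    hermMat g *ᵥ congrMap J a = congrMap J (g * a) := by
  rw [hermMat_mulVec, ofHermCoord_congrMap hJ, congrMap, conjTranspose_mul]
  simp only [Matrix.mul_assoc]

theorem det_ofHermCoord_congrMap {J : Matrix ι ι ℂ} (hJ : J.IsHermitian) (a : Matrix ι ι ℂ) :
    (ofHermCoord ι (congrMap J a)).det = ((‖a.det‖ ^ 2 : ℝ) : ℂ) * J.det :=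
  det_ofHermCoord_of_congr (ofHermCoord_congrMap hJ a)

theorem det_ofHermCoord_smul (r : ℝ) (x : ι × ι → ℝ) :
    (ofHermCoord ι (r • x)).det = (r : ℂ) ^ Fintype.card ι * (ofHermCoord ι x).det := by
  rw [map_smul, ← det_smul]
  rfl

end Congruence

section Normalization

variable {p q : ℕ}

theorem exists_slOf_congrMap [Nonempty (Fin p ⊕ Fin q)]
    (J : Matrix (Fin p ⊕ Fin q) (Fin p ⊕ Fin q) ℂ)
    {a : Matrix (Fin p ⊕ Fin q) (Fin p ⊕ Fin q) ℂ} (ha : a.det ≠ 0) :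
    ∃ (s : ℝ) (b : SLCpq p q), 0 < s ∧ s ^ Fintype.card (Fin p ⊕ Fin q) = ‖a.det‖ ∧
      (∀ i j, ‖b.val.val i j‖ = s⁻¹ * ‖a i j‖) ∧
      ∀ g, congrMap J (g * a) = s ^ 2 • congrMap J (g * b.val.val) := by
  obtain ⟨c, hc⟩ := IsAlgClosed.exists_pow_nat_eq a.det
    (Fintype.card_pos (α := Fin p ⊕ Fin q))
  have hc0 : c ≠ 0 := by
    rintro rfl
    rw [zero_pow Fintype.card_ne_zero] at hc
    exact ha hc.symm
  refine ⟨‖c‖, slOf (c⁻¹ • a) ?_, norm_pos_iff.2 hc0, by rw [← hc, norm_pow], fun i j => ?_,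
    fun g => ?_⟩
  · rw [det_smul, inv_pow, hc, inv_mul_cancel₀ ha]
  · change ‖c⁻¹ * a i j‖ = _
    rw [norm_mul, norm_inv]
  · rw [← congrMap_smul, ← Matrix.mul_smul]
    change _ = congrMap J (g * (c • c⁻¹ • a))
    rw [smul_smul, mul_inv_cancel₀ hc0, one_smul]

end Normalization

section Dynamics

variable {p q : ℕ}

theorem hermRep_mulVec_congrMap {Γ : Subgroup (SLCpq p q)}
    {J a : Matrix (Fin p ⊕ Fin q) (Fin p ⊕ Fin q) ℂ} (hJ : J.IsHermitian)
    (γ : Γ × Multiplicative ℤ) :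
    hermRep Γ γ *ᵥ congrMap J a = (2 : ℝ) ^ γ.2.toAdd • congrMap J (γ.1.1.val.val * a) := by
  rw [hermRep_apply, smul_mulVec, hermMat_mulVec_congrMap hJ]

theorem two_zpow_pos (k : ℤ) : (0 : ℝ) < 2 ^ k := zpow_pos two_pos k

theorem properOn_congrOrbit [Nonempty (Fin p ⊕ Fin q)] (Γ : Subgroup (SLCpq p q))
    [ProperlyDiscontinuousSMul Γ (SLCpq p q ⧸ SUpq p q)] :
    ProperOn (hermRep Γ) (congrOrbit (JCpq p q)) := by
  intro K hKX hK
  set n := Fintype.card (Fin p ⊕ Fin q) with hn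
  have hn0 : n ≠ 0 := Fintype.card_ne_zero
  obtain ⟨K₁, hK₁, hK₁c, hKK₁⟩ :=
    exists_isCompact_lift_congrMap isHermitian_JCpq det_JCpq_ne_zero hK hKX
  obtain ⟨C, hC, hCK⟩ := hK₁c.exists_bounds_of_pos (f := fun a => ‖a.det‖) (by fun_prop)
    fun a ha => norm_pos_iff.2 (hK₁ ha)
  obtain ⟨M, hM⟩ := (hK₁c.image (f := fun a => ∑ i, ∑ j, ‖a i j‖) (by fun_prop)).bddAbove
  have hM' : ∀ a ∈ K₁, ∀ i j, ‖a i j‖ ≤ M := fun a ha i j =>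
    ((Finset.single_le_sum (f := fun j => ‖a i j‖) (fun _ _ => norm_nonneg _)
      (Finset.mem_univ j)).trans (Finset.single_le_sum (f := fun i => ∑ j, ‖a i j‖)
        (fun _ _ => Finset.sum_nonneg fun _ _ => norm_nonneg _) (Finset.mem_univ i))).trans
      (hM ⟨a, ha, rfl⟩)
  have hC0 : 0 < C := one_pos.trans_le hC
  have key : ∀ a ∈ K₁, ∃ (s : ℝ) (b : SLCpq p q), 0 < s ∧ s ≤ C ∧ C⁻¹ ≤ s ∧
      b ∈ slBall p q (C * M) ∧
      ∀ g, congrMap (JCpq p q) (g * a) = s ^ 2 • congrMap (JCpq p q) (g * b.val.val) := by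
    intro a ha
    obtain ⟨s, b, hs, hsn, hb, hab⟩ := exists_slOf_congrMap (JCpq p q) (hK₁ ha)
    have h1 := inv_le_of_inv_le_pow hn0 hC hs (hsn ▸ (hCK a ha).2)
    refine ⟨s, b, hs, le_of_pow_le_of_one_le hn0 hC (hsn ▸ (hCK a ha).1), h1, fun i j => ?_, hab⟩
    rw [hb]
    exact mul_le_mul ((inv_le_comm₀ hC0 hs).1 h1) (hM' a ha i j) (norm_nonneg _) hC0.le
  refine (((finite_return Γ (C * M)).prod (finite_zpow_mem_Icc (C ^ 4)))).subset ?_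
  rintro γ ⟨x, hx, hγx⟩
  obtain ⟨a, ha, rfl⟩ := hKK₁ hx
  obtain ⟨b, hb, hab⟩ := hKK₁ hγx
  obtain ⟨s, a', hs, hsC, hsC', ha', hsa⟩ := key a ha
  obtain ⟨u, b', hu, huC, huC', hb', hub⟩ := key b hb
  have hr := two_zpow_pos γ.2.toAdd
  have h1 := hub 1
  rw [Matrix.one_mul, Matrix.one_mul, hab, hermRep_mulVec_congrMap isHermitian_JCpq, hsa,
    smul_smul, ← SLCpq_mul_val] at h1
  have h2 := congrArg (fun x => ‖(ofHermCoord _ x).det‖) h1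
  simp only [det_ofHermCoord_smul, det_ofHermCoord_congrMap isHermitian_JCpq, SLCpq_det,
    norm_mul, norm_pow, Complex.norm_real, norm_one] at h2
  have h3 := mul_right_cancel₀ (mul_ne_zero (by norm_num)
    (norm_ne_zero_iff.2 (det_JCpq_ne_zero (p := p) (q := q)))) h2
  rw [Real.norm_of_nonneg hr.le, Real.norm_of_nonneg hs.le, Real.norm_of_nonneg hu.le] at h3
  have h4 : (2 : ℝ) ^ γ.2.toAdd * s ^ 2 = u ^ 2 :=
    (pow_left_inj₀ (by positivity) (by positivity) hn0).1 h3
  rw [h4] at h1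
  refine ⟨⟨a', ha', b', hb', smul_right_injective _ (pow_pos hu 2).ne' h1⟩, ?_, ?_⟩
  · rw [inv_le_iff_one_le_mul₀ (by positivity)]
    have h5 : 1 ≤ C * u := (inv_le_iff_one_le_mul₀' hC0).1 huC'
    calc (1 : ℝ) ≤ (C * u) ^ 2 := one_le_pow₀ h5
      _ = C ^ 2 * (2 ^ γ.2.toAdd * s ^ 2) := by rw [h4]; ring
      _ ≤ C ^ 2 * (2 ^ γ.2.toAdd * C ^ 2) := by gcongr
      _ = _ := by ring
  · have h5 : 1 ≤ C * s := (inv_le_iff_one_le_mul₀' hC0).1 hsC'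
    calc (2 : ℝ) ^ γ.2.toAdd ≤ 2 ^ γ.2.toAdd * (C * s) ^ 2 :=
          le_mul_of_one_le_right hr.le (one_le_pow₀ h5)
      _ = C ^ 2 * (2 ^ γ.2.toAdd * s ^ 2) := by ring
      _ = C ^ 2 * u ^ 2 := by rw [h4]
      _ ≤ C ^ 2 * C ^ 2 := by gcongr
      _ = _ := by ring

theorem exists_bounds_of_mem_posCone {A B : Set ((Fin p ⊕ Fin q) × (Fin p ⊕ Fin q) → ℝ)}
    [Nonempty (Fin p ⊕ Fin q)] (hA : IsCompact A) (hAY : A ⊆ posCone (Fin p ⊕ Fin q))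
    (hB : IsCompact B) (hBY : B ⊆ posCone (Fin p ⊕ Fin q)) :
    ∃ R C : ℝ, ∀ g : SLCpq p q, ∀ r : ℝ, 0 < r → ∀ y ∈ A, r • hermMat g.val.val *ᵥ y ∈ B →
      g ∈ slBall p q R ∧ C⁻¹ ≤ r ∧ r ≤ C := by
  set n := Fintype.card (Fin p ⊕ Fin q) with hn
  have hn0 : n ≠ 0 := Fintype.card_ne_zero
  obtain ⟨C, hC, hCK⟩ := (hA.union hB).exists_bounds_of_pos
    (f := fun y => ‖(ofHermCoord (Fin p ⊕ Fin q) y).det‖)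
    (continuous_ofHermCoord.matrix_det).norm
    fun y hy => norm_pos_iff.2 (det_ne_zero_of_mem_posCone (hy.elim (@hAY y) (@hBY y)))
  obtain ⟨D, hD, hDK⟩ := (hA.prod (isCompact_sphere (0 : Fin p ⊕ Fin q → ℂ) 1)).exists_bounds_of_pos
    continuous_hermForm fun y hy => hAY hy.1 y.2 fun h => by simpa [h] using hy.2
  obtain ⟨M, hM⟩ := (hB.image (f := fun y => ∑ i, ‖ofHermCoord (Fin p ⊕ Fin q) y i i‖)
    (continuous_finsetSum _ fun i _ => (continuous_ofHermCoord.matrix_elem i i).norm)).bddAbove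
  have hC0 : 0 < C := one_pos.trans_le hC
  have hD0 : 0 < D := one_pos.trans_le hD
  refine ⟨max 1 (C ^ 2 * D * M), C ^ 2, fun g r hr y hy hgy => ?_⟩
  have hdet : r ^ n * ‖(ofHermCoord _ y).det‖ =
      ‖(ofHermCoord _ (r • hermMat g.val.val *ᵥ y)).det‖ := by
    rw [det_ofHermCoord_smul, ofHermCoord_hermMat_mulVec, det_mul, det_mul, det_conjTranspose,
      SLCpq_det, star_one, mul_one, one_mul, norm_mul, norm_pow, Complex.norm_real,
      Real.norm_of_nonneg hr.le]
  have hyC := hCK y (Or.inl hy)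
  have hgC := hCK _ (Or.inr hgy)
  rw [← hdet] at hgC
  have hC1 : 1 ≤ C * ‖(ofHermCoord _ y).det‖ := (inv_le_iff_one_le_mul₀' hC0).1 hyC.2
  have hC2 : 1 ≤ C * (r ^ n * ‖(ofHermCoord _ y).det‖) := (inv_le_iff_one_le_mul₀' hC0).1 hgC.2
  have hr1 : r ≤ C ^ 2 := by
    refine le_of_pow_le_of_one_le hn0 (one_le_pow₀ hC) ?_
    calc r ^ n ≤ r ^ n * (C * ‖(ofHermCoord _ y).det‖) := le_mul_of_one_le_right (by positivity) hC1
      _ = C * (r ^ n * ‖(ofHermCoord _ y).det‖) := by ring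
      _ ≤ C * C := by gcongr; exact hgC.1
      _ = C ^ 2 := by ring
  have hr2 : (C ^ 2)⁻¹ ≤ r := by
    refine inv_le_of_inv_le_pow hn0 (one_le_pow₀ hC) hr ?_
    rw [inv_le_iff_one_le_mul₀' (by positivity)]
    calc 1 ≤ C * (r ^ n * ‖(ofHermCoord _ y).det‖) := hC2
      _ ≤ C * (r ^ n * C) := by gcongr; exact hyC.1
      _ = C ^ 2 * r ^ n := by ring
  refine ⟨fun i j => ?_, hr2, hr1⟩
  set v : Fin p ⊕ Fin q → ℂ := g.val.valᴴ *ᵥ Pi.single i 1 with hv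
  have hvj : ‖g.val.val i j‖ ≤ ‖v‖ := by
    refine le_trans (le_of_eq ?_) (norm_le_pi_norm v j)
    simp [hv]
  have hform : ‖v‖ ^ 2 * D⁻¹ ≤ (star v ⬝ᵥ (ofHermCoord _ y *ᵥ v)).re := by
    rcases eq_or_ne v 0 with h0 | h0
    · simp [h0]
    have hn : 0 < ‖v‖ := norm_pos_iff.2 h0
    have h1 := (hDK (y, ((‖v‖⁻¹ : ℝ) : ℂ) • v) ⟨hy, by
      rw [mem_sphere_zero_iff_norm, norm_smul, Complex.norm_real, norm_inv, norm_norm,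
        inv_mul_cancel₀ hn.ne']⟩).2
    rw [hermForm_smul, inv_pow, inv_mul_eq_div, le_div_iff₀ (pow_pos hn 2)] at h1
    rwa [mul_comm]
  have hdiag : (ofHermCoord _ (r • hermMat g.val.val *ᵥ y) i i).re =
      r * (star v ⬝ᵥ (ofHermCoord _ y *ᵥ v)).re := by
    rw [hv, ← hermForm_congr, map_smul, ofHermCoord_hermMat_mulVec]
    simp
  have hMi : r * (star v ⬝ᵥ (ofHermCoord _ y *ᵥ v)).re ≤ M := by
    rw [← hdiag]
    exact ((Complex.re_le_norm _).trans (Finset.single_le_sum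
      (f := fun i => ‖ofHermCoord _ (r • hermMat g.val.val *ᵥ y) i i‖)
      (fun _ _ => norm_nonneg _) (Finset.mem_univ i))).trans (hM ⟨_, hgy, rfl⟩)
  refine hvj.trans (le_of_pow_le_of_one_le two_ne_zero (le_max_left _ _)
    (le_trans ?_ (le_max_right _ _)))
  rw [← div_eq_mul_inv, div_le_iff₀ hD0] at hform
  have hr3 : 1 ≤ C ^ 2 * r := (inv_le_iff_one_le_mul₀' (by positivity)).1 hr2
  calc ‖v‖ ^ 2 ≤ (star v ⬝ᵥ (ofHermCoord _ y *ᵥ v)).re * D := hform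
    _ ≤ (star v ⬝ᵥ (ofHermCoord _ y *ᵥ v)).re * D * (C ^ 2 * r) :=
      le_mul_of_one_le_right ((sq_nonneg _).trans hform) hr3
    _ = C ^ 2 * D * (r * (star v ⬝ᵥ (ofHermCoord _ y *ᵥ v)).re) := by ring
    _ ≤ C ^ 2 * D * M := by gcongr

theorem properOn_posCone [Nonempty (Fin p ⊕ Fin q)] (Γ : Subgroup (SLCpq p q))
    [ProperlyDiscontinuousSMul Γ (SLCpq p q ⧸ SUpq p q)] :
    ProperOn (hermRep Γ) (posCone (Fin p ⊕ Fin q)) := by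
  intro K hKY hK
  obtain ⟨R, C, hRC⟩ := exists_bounds_of_mem_posCone hK hKY hK hKY
  refine (((finite_return Γ (max R 1)).prod (finite_zpow_mem_Icc C))).subset ?_
  rintro γ ⟨y, hy, hγy⟩
  rw [hermRep_apply, smul_mulVec] at hγy
  obtain ⟨h1, h2⟩ := hRC γ.1.1 _ (two_zpow_pos _) y hy hγy
  refine ⟨⟨1, fun i j => ?_, γ.1.1, fun i j => (h1 i j).trans (le_max_left _ _), ?_⟩, h2⟩
  · refine le_trans ?_ (le_max_right _ _)
    rw [SLCpq_one_val, one_apply]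
    split_ifs <;> simp
  · rw [mul_one]

theorem exists_compact_congrOrbit [Nonempty (Fin p ⊕ Fin q)] (Γ : Subgroup (SLCpq p q))
    [CompactSpace (MulAction.orbitRel.Quotient Γ (SLCpq p q ⧸ SUpq p q))] :
    ∃ C ⊆ congrOrbit (JCpq p q), IsCompact C ∧
      ∀ x ∈ congrOrbit (JCpq p q), ∃ γ, hermRep Γ γ *ᵥ x ∈ C := by
  obtain ⟨R, hR⟩ := exists_slBall_cover Γ
  refine ⟨(fun z : ℝ × SLCpq p q => z.1 • congrMap (JCpq p q) z.2.val.val) ''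
    (Set.Icc 1 2 ×ˢ slBall p q R), ?_, (isCompact_Icc.prod (isCompact_slBall R)).image ?_, ?_⟩
  · rintro _ ⟨⟨r, g⟩, ⟨hr, hg⟩, rfl⟩
    have := smul_congr_mem_congrOrbit (J := JCpq p q) (one_pos.trans_le hr.1)
      (a := g.val.val) (by simp [SLCpq_det]) isHermitian_JCpq
    rwa [map_smul] at this
  · exact continuous_fst.smul
      ((continuous_congrMap _).comp (continuous_SLCpq_val.comp continuous_snd))
  · intro x hx
    rw [congrOrbit_eq_image isHermitian_JCpq] at hx
    obtain ⟨a, ha, rfl⟩ := hx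
    obtain ⟨s, a', hs, -, -, hsa⟩ := exists_slOf_congrMap (JCpq p q) ha
    obtain ⟨γ, b, hb, hγb⟩ := hR a'
    obtain ⟨k, hk⟩ := exists_mem_Ico_zpow (pow_pos hs 2) (one_lt_two (α := ℝ))
    refine ⟨(γ, Multiplicative.ofAdd (-k)), (2 ^ (-k) * s ^ 2, b), ⟨⟨?_, ?_⟩, hb⟩, ?_⟩
    · rw [_root_.zpow_neg, inv_mul_eq_div, one_le_div₀ (two_zpow_pos k)]
      exact hk.1
    · rw [_root_.zpow_neg, inv_mul_eq_div, div_le_iff₀ (two_zpow_pos k), mul_comm,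
        ← zpow_add_one₀ two_ne_zero]
      exact hk.2.le
    · rw [hermRep_mulVec_congrMap isHermitian_JCpq, hsa, smul_smul]
      exact congrArg _ hγb.symm

end Dynamics

section Unipotent

variable {p q : ℕ}

/-- The vector `e_i + e_j` with `i` a positive and `j` a negative index. -/
def isoVec (i : Fin p) (j : Fin q) : Fin p ⊕ Fin q → ℂ :=
  Sum.elim (Pi.single i 1) (Pi.single j 1)

/-- The rank one nilpotent matrix `v vᵀ J`, where `v = isoVec i j`. -/
def isoNil (i : Fin p) (j : Fin q) : Matrix (Fin p ⊕ Fin q) (Fin p ⊕ Fin q) ℂ :=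
  vecMulVec (isoVec i j) (Sum.elim (Pi.single i 1) (-Pi.single j 1))

theorem isoVec_dotProduct (i : Fin p) (j : Fin q) :
    (Sum.elim (Pi.single i 1) (-Pi.single j 1)) ⬝ᵥ isoVec i j = 0 := by
  simp [isoVec, dotProduct, Fintype.sum_sum_type, Pi.single_apply]

theorem isoNil_mul_self (i : Fin p) (j : Fin q) : isoNil i j * isoNil i j = 0 := by
  rw [isoNil, vecMulVec_mul_vecMulVec, isoVec_dotProduct]
  simp

theorem isoNil_mul_JCpq (i : Fin p) (j : Fin q) :
    isoNil i j * JCpq p q = vecMulVec (isoVec i j) (isoVec i j) := by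
  ext a b
  rw [JCpq, mul_diagonal]
  rcases b with b | b <;> simp [isoNil, isoVec, vecMulVec_apply]

theorem det_one_add_isoNil (i : Fin p) (j : Fin q) (c : ℂ) : (1 + c • isoNil i j).det = 1 := by
  rw [isoNil, ← smul_vecMulVec, vecMulVec_eq Unit, det_one_add_replicateCol_mul_replicateRow,
    dotProduct_smul, isoVec_dotProduct, smul_zero, add_zero]

theorem one_add_isoNil_conj (i : Fin p) (j : Fin q) (s : ℝ) :
    (1 + (Complex.I * s) • isoNil i j) * JCpq p q * (1 + (Complex.I * s) • isoNil i j)ᴴ =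
      JCpq p q := by
  set N := isoNil i j
  set J := JCpq p q
  have h1 : (N * J)ᴴ = N * J := by
    rw [isoNil_mul_JCpq, conjTranspose_vecMulVec]
    have : star (isoVec i j) = isoVec i j := by
      ext a
      rcases a with a | a <;> simp [isoVec, Pi.single_apply, apply_ite]
    rw [this]
  have h2 : J * Nᴴ = N * J := by
    rw [← h1, conjTranspose_mul, isHermitian_JCpq.eq]
  have h3 : N * J * Nᴴ = 0 := by
    rw [Matrix.mul_assoc, h2, ← Matrix.mul_assoc, isoNil_mul_self, Matrix.zero_mul]
  rw [conjTranspose_add, conjTranspose_one, conjTranspose_smul, Matrix.mul_add, Matrix.mul_one,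
    Matrix.add_mul, Matrix.one_mul, Matrix.mul_smul, Matrix.add_mul, Matrix.smul_mul,
    Matrix.smul_mul, h2, h3, smul_zero, add_zero, add_assoc, ← add_smul]
  simp

theorem exists_mem_SUpq_entry (i : Fin p) (j : Fin q) (s : ℝ) :
    ∃ h ∈ SUpq p q, ‖h.val.val (Sum.inl i) (Sum.inr j)‖ = |s| := by
  refine ⟨slOf _ (det_one_add_isoNil i j (Complex.I * s)),
    mem_SUpq_of_conj (one_add_isoNil_conj i j s), ?_⟩
  change ‖(1 + (Complex.I * s) • isoNil i j) (Sum.inl i) (Sum.inr j)‖ = |s|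
  simp [isoNil, isoVec, vecMulVec_apply]

theorem exists_posCone_forall_notMem (hp : 0 < p) (hq : 0 < q) (Γ : Subgroup (SLCpq p q))
    [ProperlyDiscontinuousSMul Γ (SLCpq p q ⧸ SUpq p q)]
    {B : Set ((Fin p ⊕ Fin q) × (Fin p ⊕ Fin q) → ℝ)} (hBY : B ⊆ posCone (Fin p ⊕ Fin q))
    (hB : IsCompact B) : ∃ y ∈ posCone (Fin p ⊕ Fin q), ∀ γ, hermRep Γ γ *ᵥ y ∉ B := by
  have : Nonempty (Fin p ⊕ Fin q) := ⟨Sum.inl ⟨0, hp⟩⟩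
  have hmem : ∀ g : SLCpq p q, congrMap 1 g.val.val ∈ posCone (Fin p ⊕ Fin q) := fun g => by
    rw [congrMap, Matrix.mul_one]
    exact toHermCoord_mul_conjTranspose_mem_posCone (by simp [SLCpq_det])
  obtain ⟨R, C, hRC⟩ := exists_bounds_of_mem_posCone
    (isCompact_singleton (x := congrMap 1 (1 : SLCpq p q).val.val))
    (Set.singleton_subset_iff.2 (hmem 1)) hB hBY
  have hfin := finite_return Γ (max R 1)
  obtain ⟨M, hM⟩ := (hfin.image fun γ : Γ => ∑ a, ∑ b, ‖γ.1.val.val a b‖).bddAbove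
  by_contra! hcon
  obtain ⟨h, hh, hentry⟩ := exists_mem_SUpq_entry (⟨0, hp⟩ : Fin p) (⟨0, hq⟩ : Fin q)
    (M * max R 1 + 1)
  obtain ⟨γ, hγ⟩ := hcon _ (hmem h)
  rw [hermRep_mulVec_congrMap isHermitian_one, ← SLCpq_mul_val] at hγ
  have h1 : γ.1.1 * h ∈ slBall p q R := (hRC _ _ (two_zpow_pos _) _ rfl (by
    rw [hermMat_mulVec_congrMap isHermitian_one, SLCpq_one_val, Matrix.mul_one]
    exact hγ)).1
  have h1' : ∀ a b, ‖(γ.1.1 * h).val.val a b‖ ≤ max R 1 := fun a b =>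
    (h1 a b).trans (le_max_left _ _)
  have h2 := hM ⟨γ.1⁻¹, ⟨γ.1.1 * h, h1', 1, fun a b => ?_, ?_⟩, rfl⟩
  · have hR0 : 0 ≤ max R 1 := zero_le_one.trans (le_max_right _ _)
    have hprod : h = (γ.1⁻¹).1 * (γ.1.1 * h) := by simp
    have h3 : ‖h.val.val (Sum.inl ⟨0, hp⟩) (Sum.inr ⟨0, hq⟩)‖ ≤ M * max R 1 := by
      rw [congrArg (fun g : SLCpq p q => g.val.val) hprod, SLCpq_mul_val, mul_apply]
      refine (norm_sum_le _ _).trans (le_trans ?_ (mul_le_mul_of_nonneg_right h2 hR0))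
      refine le_trans ?_ (mul_le_mul_of_nonneg_right (Finset.single_le_sum
        (f := fun a => ∑ b, ‖(γ.1⁻¹).1.val.val a b‖)
        (fun _ _ => Finset.sum_nonneg fun _ _ => norm_nonneg _)
        (Finset.mem_univ (Sum.inl ⟨0, hp⟩))) hR0)
      rw [Finset.sum_mul]
      refine Finset.sum_le_sum fun b _ => ?_
      rw [norm_mul]
      exact mul_le_mul_of_nonneg_left (h1' _ _) (norm_nonneg _)
    rw [hentry] at h3
    exact absurd ((le_abs_self _).trans h3) (not_le.2 (lt_add_one _))
  · refine le_trans ?_ (le_max_right _ _)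
    rw [SLCpq_one_val, one_apply]
    split_ifs <;> simp
  · refine (congrMap_eq_of_inv_mul_mem ?_).symm
    simpa using hh

end Unipotent

/-- **No compact Clifford–Klein forms for `SL(p+q,ℂ)/SU(p,q)`, `p, q > 0`.**
There is no discrete subgroup `Γ` of `G = SL(p+q,ℂ)` acting properly discontinuously and
cocompactly on the homogeneous space `G/H`, where `H = SU(p,q)`. -/
theorem no_compact_CliffordKlein_form_SLC_SUpq (p q : ℕ) (hp : 0 < p) (hq : 0 < q) :
    ¬ ∃ Γ : Subgroup ↥(SLCpq p q), DiscreteTopology ↥Γ ∧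
      ProperlyDiscontinuousSMul ↥Γ (↥(SLCpq p q) ⧸ SUpq p q) ∧
      CompactSpace (MulAction.orbitRel.Quotient ↥Γ (↥(SLCpq p q) ⧸ SUpq p q)) := by
  rintro ⟨Γ, -, _, _⟩
  have : Nonempty (Fin p ⊕ Fin q) := ⟨Sum.inl ⟨0, hp⟩⟩
  have hdetpos : ∀ γ : Γ × Multiplicative ℤ, 0 < (hermRep Γ γ).det := fun γ => by
    have h2 : ((hermMat γ.1.1.val.val).det : ℂ) = 1 := by simp [det_hermMat, SLCpq_det]
    have h3 : (hermMat γ.1.1.val.val).det = 1 := by exact_mod_cast h2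
    rw [hermRep_apply, det_smul, h3, mul_one]
    exact pow_pos (two_zpow_pos _) _
  have hdet : ∀ g : SLCpq p q, g.val.val.det ≠ 0 := fun g => by simp [SLCpq_det]
  exact false_of_proper_cocompact (hermRep Γ) hdetpos
    (isOpen_congrOrbit isHermitian_JCpq det_JCpq_ne_zero)
    ⟨congrMap _ 1, 1, by simp, ofHermCoord_congrMap isHermitian_JCpq 1⟩
    (fun γ x hx => smul_hermMat_mulVec_mem_congrOrbit isHermitian_JCpq (two_zpow_pos _) (hdet _) hx)
    (properOn_congrOrbit Γ) isOpen_posCone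
    ⟨_, toHermCoord_mul_conjTranspose_mem_posCone (hdet 1)⟩
    (fun γ y hy => smul_hermMat_mulVec_mem_posCone (two_zpow_pos _) (hdet _) hy)
    (properOn_posCone Γ) (fun _ hy _ hz => add_mem_posCone hy hz)
    (fun _ hr _ hy => smul_mem_posCone hr hy) (exists_compact_congrOrbit Γ)
    (fun B hBY hB => exists_posCone_forall_notMem hp hq Γ hBY hB)
    (w := invDensity (Fin p ⊕ Fin q))
    (fun x hx y hy t =>
      contDiffAt_invDensity (det_hermCoord_segment_ne_zero det_JCpq_ne_zero hx hy t))
    (fun γ z => invDensity_smul_hermMat (two_zpow_pos _).ne' (SLCpq_det _) z)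
    ⟨_, fun x hx => re_invDensity_pos det_JCpq_ne_zero hx⟩
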